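/- arXiv:1311.2298 — 4 statements merged into one kernel-verified Lean document; each statement's English description precedes it below -/
import Mathlib

section
/- Let m be a positive integer, and let n be the unique integer with 2^{n-1} < m ≤ 2^n. Set m' = 2^n − m. Then the minimum of ‖𝒜‖ over all union-closed families 𝒜 of finite sets of positive integers with |𝒜| = m equals ‖𝒫(n)‖ − ‖I(m')‖ − m' (where ‖𝒫(n)‖ = n·2^{n−1}). -/
open Finset
open scoped Classical

/-- The total size `‖𝒜‖ = Σ_{A∈𝒜} |A|` of a family of finite sets. -/
def totalSize (𝒜 : Finset (Finset ℕ)) : ℕ := ∑ A ∈ 𝒜, A.card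

/-- A family is union-closed if it is closed under pairwise unions. -/
def UnionClosed (𝒜 : Finset (Finset ℕ)) : Prop := ∀ A ∈ 𝒜, ∀ B ∈ 𝒜, A ∪ B ∈ 𝒜

/-- The `k`-th finite set of positive integers in the colex order: the positive
integer `i` belongs to it iff bit `i - 1` of `k` is set. -/
def colexSet (k : ℕ) : Finset ℕ :=
  ((Finset.range (k + 1)).filter fun i => k.testBit i).image (· + 1)

/-- The initial segment `I(m)` of length `m` of the colex order on finite sets
of positive integers. -/
def colexInit (m : ℕ) : Finset (Finset ℕ) := (Finset.range m).image colexSet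

/-- A family `ℬ` is simply rooted if every nonempty `B ∈ ℬ` has some `b ∈ B`
with the whole cube `[{b}, B]` contained in `ℬ`. -/
def SimplyRooted (ℬ : Finset (Finset ℕ)) : Prop :=
  ∀ B ∈ ℬ, B.Nonempty → ∃ b ∈ B, ∀ C : Finset ℕ, {b} ⊆ C → C ⊆ B → C ∈ ℬ

/-- `B` is `ℬ`-rooted at `i`: `i ∈ B` and the cube `[{i}, B]` lies in `ℬ`. -/
def RootedAt (ℬ : Finset (Finset ℕ)) (B : Finset ℕ) (i : ℕ) : Prop :=
  i ∈ B ∧ ∀ C : Finset ℕ, {i} ⊆ C → C ⊆ B → C ∈ ℬ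

/-- `ℬ_S`: the sets of `ℬ` that are `ℬ`-rooted at some element of `S`. -/
noncomputable def rootedFam (ℬ : Finset (Finset ℕ)) (S : Finset ℕ) : Finset (Finset ℕ) :=
  ℬ.filter fun B => ∃ i ∈ S, RootedAt ℬ B i

/-- The image of a single set `B` under the down-compression of `ℬ` in
direction `i`. -/
def compressSet (ℬ : Finset (Finset ℕ)) (i : ℕ) (B : Finset ℕ) : Finset ℕ :=
  if i ∈ B ∧ B.erase i ∉ ℬ then B.erase i else B

/-- The down-compression `d_i(ℬ)` of the family `ℬ` in direction `i`. -/
def dComp (i : ℕ) (ℬ : Finset (Finset ℕ)) : Finset (Finset ℕ) :=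
  ℬ.image (compressSet ℬ i)

/-- `D_k(ℬ) = d_k(⋯ d_1(ℬ) ⋯)`.  In particular `d(ℬ) = D_n(ℬ)` for
`ℬ ⊆ 𝒫(n)`. -/
def DComp : ℕ → Finset (Finset ℕ) → Finset (Finset ℕ)
  | 0, ℬ => ℬ
  | k + 1, ℬ => dComp (k + 1) (DComp k ℬ)

/-- `D_{(ℬ,k)}(B)`: the image of the set `B` obtained by following `B` through
the successive compressions `d_1, …, d_k`.  In particular `d_ℬ(B) = D_{(ℬ,n)}(B)`
for `ℬ ⊆ 𝒫(n)`. -/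
def DCompSet : ℕ → Finset (Finset ℕ) → Finset ℕ → Finset ℕ
  | 0, _, B => B
  | k + 1, ℬ, B => compressSet (DComp k ℬ) (k + 1) (DCompSet k ℬ B)

/-- The shadow `δB = {B \ {i} : i ∈ B}` of a finite set `B`. -/
def shadowSet (B : Finset ℕ) : Finset (Finset ℕ) := B.image fun i => B.erase i

/-- `B` is a bad set of `ℬ ⊆ 𝒫(n)` if `δB ⊆ ℬ` or `d_ℬ(B) = B`. -/
def BadSet (n : ℕ) (ℬ : Finset (Finset ℕ)) (B : Finset ℕ) : Prop :=
  shadowSet B ⊆ ℬ ∨ DCompSet n ℬ B = B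

/-- A family is a down-set if it is closed under taking subsets. -/
def IsDownSet (𝒟 : Finset (Finset ℕ)) : Prop := ∀ A ∈ 𝒟, ∀ B ⊆ A, B ∈ 𝒟

/-- The deficiency `def(ℬ) = Σ_{B∈ℬ} |δB \ ℬ|`. -/
def deficiency (ℬ : Finset (Finset ℕ)) : ℕ := ∑ B ∈ ℬ, (shadowSet B \ ℬ).card

/-- `𝒜 ⊆ 𝒫(n)` is a counterexample to the union-closed conjecture:
union-closed, not `{∅}`, and every element of `[n]` has degree `< |𝒜|/2`. -/
def UCCounterexample (n : ℕ) (𝒜 : Finset (Finset ℕ)) : Prop :=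
  𝒜 ⊆ (Finset.Icc 1 n).powerset ∧ UnionClosed 𝒜 ∧ 𝒜 ≠ {∅} ∧
    ∀ i ∈ Finset.Icc 1 n, ((𝒜.filter fun A => i ∈ A).card : ℚ) < (𝒜.card : ℚ) / 2

lemma mem_colexSet {k i : ℕ} : i ∈ colexSet k ↔ ∃ j, k.testBit j = true ∧ j + 1 = i := by
  simp only [colexSet, mem_image, mem_filter, mem_range]
  constructor
  · rintro ⟨j, ⟨-, h⟩, rfl⟩
    exact ⟨j, h, rfl⟩
  · rintro ⟨j, h, rfl⟩
    exact ⟨j, ⟨(Nat.lt_two_pow_self.trans_le (Nat.ge_two_pow_of_testBit h)).trans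
      (Nat.lt_succ_self k), h⟩, rfl⟩

lemma succ_mem_colexSet {k j : ℕ} : j + 1 ∈ colexSet k ↔ k.testBit j = true := by
  simp [mem_colexSet]

lemma le_of_colexSet_subset {j k : ℕ} (h : colexSet j ⊆ colexSet k) : j ≤ k := by
  have hjk : j &&& k = j := by
    apply Nat.eq_of_testBit_eq
    intro i
    rw [Nat.testBit_and]
    by_cases hi : j.testBit i = true
    · simp [hi, succ_mem_colexSet.1 (h (succ_mem_colexSet.2 hi))]
    · simp [hi]
  exact hjk ▸ Nat.and_le_right

lemma colexSet_injective : Function.Injective colexSet := fun _ _ h =>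
  le_antisymm (le_of_colexSet_subset h.subset) (le_of_colexSet_subset h.superset)

lemma colexSet_subset_Icc {n k : ℕ} (hk : k < 2 ^ n) : colexSet k ⊆ Icc 1 n := by
  intro i hi
  obtain ⟨j, hj, rfl⟩ := mem_colexSet.1 hi
  have : 2 ^ j < 2 ^ n := (Nat.ge_two_pow_of_testBit hj).trans_lt hk
  have := (Nat.pow_lt_pow_iff_right (by norm_num : 1 < 2)).1 this
  simp only [mem_Icc]
  omega

lemma card_colexInit (m : ℕ) : (colexInit m).card = m := by
  rw [colexInit, card_image_of_injective _ colexSet_injective, card_range]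

lemma colexInit_two_pow (n : ℕ) : colexInit (2 ^ n) = (Icc 1 n).powerset := by
  apply eq_of_subset_of_card_le
  · intro A hA
    obtain ⟨k, hk, rfl⟩ := mem_image.1 hA
    exact mem_powerset.2 (colexSet_subset_Icc (mem_range.1 hk))
  · simp [card_colexInit]

lemma totalSize_colexInit (m : ℕ) :
    totalSize (colexInit m) = ∑ k ∈ range m, (colexSet k).card := by
  rw [totalSize, colexInit, sum_image colexSet_injective.injOn]

lemma totalSize_colexInit_succ (m : ℕ) :
    totalSize (colexInit (m + 1)) = totalSize (colexInit m) + (colexSet m).card := by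
  rw [totalSize_colexInit, totalSize_colexInit, sum_range_succ]

lemma card_colexSet_two_mul (k : ℕ) : (colexSet (2 * k)).card = (colexSet k).card := by
  have : colexSet (2 * k) = (colexSet k).image (· + 1) := by
    ext i
    simp only [mem_colexSet, mem_image]
    constructor
    · rintro ⟨_ | j, hj, rfl⟩
      · simp at hj
      · exact ⟨j + 1, ⟨j, by simpa [Nat.testBit_succ] using hj, rfl⟩, rfl⟩
    · rintro ⟨_, ⟨j, hj, rfl⟩, rfl⟩
      exact ⟨j + 1, by simpa [Nat.testBit_succ] using hj, rfl⟩
  rw [this, card_image_of_injective _ (add_left_injective 1)]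

lemma card_colexSet_two_mul_add_one (k : ℕ) :
    (colexSet (2 * k + 1)).card = (colexSet k).card + 1 := by
  have : colexSet (2 * k + 1) = insert 1 ((colexSet k).image (· + 1)) := by
    ext i
    simp only [mem_colexSet, mem_image, mem_insert]
    constructor
    · rintro ⟨_ | j, hj, rfl⟩
      · simp
      · refine Or.inr ⟨j + 1, ⟨j, ?_, rfl⟩, rfl⟩
        rw [Nat.testBit_succ] at hj
        rwa [show (2 * k + 1) / 2 = k by omega] at hj
    · rintro (rfl | ⟨_, ⟨j, hj, rfl⟩, rfl⟩)
      · exact ⟨0, by simp, rfl⟩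
      · refine ⟨j + 1, ?_, rfl⟩
        rwa [Nat.testBit_succ, show (2 * k + 1) / 2 = k by omega]
  rw [this, card_insert_of_notMem, card_image_of_injective _ (add_left_injective 1)]
  intro h
  obtain ⟨i, hi, h⟩ := mem_image.1 h
  obtain ⟨j, -, rfl⟩ := mem_colexSet.1 hi
  simp at h

lemma totalSize_colexInit_two_mul (m : ℕ) :
    totalSize (colexInit (2 * m)) = 2 * totalSize (colexInit m) + m := by
  induction m with
  | zero => simp [totalSize_colexInit]
  | succ m ih =>
    rw [show 2 * (m + 1) = 2 * m + 1 + 1 by ring, totalSize_colexInit_succ,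
      totalSize_colexInit_succ, ih, card_colexSet_two_mul, card_colexSet_two_mul_add_one,
      totalSize_colexInit_succ]
    ring

lemma totalSize_colexInit_two_mul_add_one (m : ℕ) :
    totalSize (colexInit (2 * m + 1)) =
      totalSize (colexInit m) + totalSize (colexInit (m + 1)) + m := by
  rw [totalSize_colexInit_succ, totalSize_colexInit_two_mul, card_colexSet_two_mul,
    totalSize_colexInit_succ]
  ring

lemma totalSize_colexInit_add_le (a b : ℕ) :
    totalSize (colexInit a) + totalSize (colexInit b) + min a b
      ≤ totalSize (colexInit (a + b)) := by
  induction h : a + b using Nat.strong_induction_on generalizing a b with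
  | _ s ih =>
    subst h
    have ih' (c d : ℕ) (h : c + d < a + b) := ih (c + d) h c d rfl
    clear ih
    have h0 : totalSize (colexInit 0) = 0 := by simp [totalSize_colexInit]
    rcases Nat.eq_zero_or_pos a with rfl | ha
    · simp [h0]
    rcases Nat.eq_zero_or_pos b with rfl | hb
    · simp [h0]
    obtain ⟨c, rfl | rfl⟩ := Nat.even_or_odd' a <;> obtain ⟨d, rfl | rfl⟩ := Nat.even_or_odd' b
    · have h1 := ih' c d (by omega)
      rw [← mul_add]
      simp only [totalSize_colexInit_two_mul]
      omega
    · have h1 := ih' c d (by omega)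
      have h2 := ih' c (d + 1) (by omega)
      rw [show 2 * c + (2 * d + 1) = 2 * (c + d) + 1 by ring]
      simp only [totalSize_colexInit_two_mul, totalSize_colexInit_two_mul_add_one]
      rw [← add_assoc] at h2
      omega
    · have h1 := ih' c d (by omega)
      have h2 := ih' (c + 1) d (by omega)
      rw [show 2 * c + 1 + 2 * d = 2 * (c + d) + 1 by ring]
      simp only [totalSize_colexInit_two_mul, totalSize_colexInit_two_mul_add_one]
      rw [show c + 1 + d = c + d + 1 by ring] at h2
      omega
    · have h1 := ih' c (d + 1) (by omega)
      have h2 := ih' (c + 1) d (by omega)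
      rw [show 2 * c + 1 + (2 * d + 1) = 2 * (c + d + 1) by ring]
      simp only [totalSize_colexInit_two_mul, totalSize_colexInit_two_mul_add_one]
      rw [← add_assoc] at h1
      rw [show c + 1 + d = c + d + 1 by ring] at h2
      omega

lemma colexSet_two_pow_sub {n k : ℕ} (hk : k < 2 ^ n) :
    colexSet (2 ^ n - (k + 1)) = Icc 1 n \ colexSet k := by
  ext i
  rcases i with _ | j
  · simp [mem_colexSet]
  · simp only [mem_sdiff, succ_mem_colexSet, Nat.testBit_two_pow_sub_succ hk, mem_Icc]
    simp

lemma card_colexSet_two_pow_sub {n k : ℕ} (hk : k < 2 ^ n) :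
    (colexSet (2 ^ n - (k + 1))).card + (colexSet k).card = n := by
  rw [colexSet_two_pow_sub hk, card_sdiff_add_card_eq_card (colexSet_subset_Icc hk)]
  simp

lemma totalSize_colexInit_two_pow_sub {n b : ℕ} (hb : b ≤ 2 ^ n) :
    totalSize (colexInit (2 ^ n - b)) + n * b =
      totalSize (colexInit (2 ^ n)) + totalSize (colexInit b) := by
  induction b with
  | zero => simp [totalSize_colexInit]
  | succ b ih =>
    have h1 := ih (by omega)
    have h2 := card_colexSet_two_pow_sub (Nat.lt_of_succ_le hb)
    have h3 := totalSize_colexInit_succ (2 ^ n - (b + 1))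
    rw [show 2 ^ n - (b + 1) + 1 = 2 ^ n - b by omega] at h3
    rw [totalSize_colexInit_succ, mul_add]
    omega

lemma totalSize_memberSubfamily_add (𝒟 : Finset (Finset ℕ)) (i : ℕ) :
    totalSize 𝒟 = totalSize (𝒟.nonMemberSubfamily i) + totalSize (𝒟.memberSubfamily i)
      + (𝒟.memberSubfamily i).card := by
  have h1 : totalSize (𝒟.memberSubfamily i) + (𝒟.memberSubfamily i).card
      = ∑ A ∈ 𝒟 with i ∈ A, A.card := by
    have hinj : Set.InjOn (fun A : Finset ℕ => A.erase i) (𝒟.filter fun A => i ∈ A) := by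
      intro A hA B hB h
      rw [← insert_erase (mem_filter.1 hA).2, ← insert_erase (mem_filter.1 hB).2]
      exact congrArg (insert i) h
    rw [totalSize, memberSubfamily, sum_image hinj, card_image_of_injOn hinj, card_eq_sum_ones,
      ← sum_add_distrib]
    exact sum_congr rfl fun A hA => card_erase_add_one (mem_filter.1 hA).2
  rw [add_assoc, h1, totalSize, totalSize, nonMemberSubfamily, add_comm,
    sum_filter_add_sum_filter_not]

/-- A down-set of `m` sets has total size at most that of the initial segment of colex. -/
lemma totalSize_le_of_isDownSet (S : Finset ℕ) : ∀ 𝒟 : Finset (Finset ℕ), 𝒟 ⊆ S.powerset →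
    IsDownSet 𝒟 → totalSize 𝒟 ≤ totalSize (colexInit 𝒟.card) := by
  induction S using Finset.induction_on with
  | empty =>
    intro 𝒟 h𝒟 _
    have : totalSize 𝒟 = 0 := sum_eq_zero fun A hA => by
      simpa using h𝒟 hA
    omega
  | insert i S hi ih =>
    intro 𝒟 h𝒟 hdown
    have hsub : 𝒟.memberSubfamily i ⊆ 𝒟.nonMemberSubfamily i := by
      intro A hA
      rw [mem_memberSubfamily] at hA
      exact mem_nonMemberSubfamily.2 ⟨hdown _ hA.1 _ (subset_insert _ _), hA.2⟩
    have h0 : totalSize (𝒟.nonMemberSubfamily i)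
        ≤ totalSize (colexInit (𝒟.nonMemberSubfamily i).card) := by
      apply ih
      · intro A hA
        rw [mem_nonMemberSubfamily] at hA
        exact mem_powerset.2 ((subset_insert_iff_of_notMem hA.2).1 (mem_powerset.1 (h𝒟 hA.1)))
      · intro A hA B hB
        rw [mem_nonMemberSubfamily] at hA ⊢
        exact ⟨hdown A hA.1 B hB, fun h => hA.2 (hB h)⟩
    have h1 : totalSize (𝒟.memberSubfamily i)
        ≤ totalSize (colexInit (𝒟.memberSubfamily i).card) := by
      apply ih
      · intro A hA
        rw [mem_memberSubfamily] at hA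
        have := (subset_insert _ _).trans (mem_powerset.1 (h𝒟 hA.1))
        exact mem_powerset.2 ((subset_insert_iff_of_notMem hA.2).1 this)
      · intro A hA B hB
        rw [mem_memberSubfamily] at hA ⊢
        exact ⟨hdown _ hA.1 _ (insert_subset_insert i hB), fun h => hA.2 (hB h)⟩
    have h2 := totalSize_colexInit_add_le (𝒟.nonMemberSubfamily i).card
      (𝒟.memberSubfamily i).card
    rw [min_eq_right (card_le_card hsub)] at h2
    rw [totalSize_memberSubfamily_add 𝒟 i, ← card_memberSubfamily_add_card_nonMemberSubfamily i 𝒟,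
      add_comm (𝒟.memberSubfamily i).card]
    omega

/-- The image of a set `A` under the up-compression of `ℱ` in direction `i`. -/
noncomputable def upCompressSet (ℱ : Finset (Finset ℕ)) (i : ℕ) (A : Finset ℕ) : Finset ℕ :=
  if insert i A ∈ ℱ then A else insert i A

section UpCompression

variable {ℱ : Finset (Finset ℕ)} {i : ℕ} {A : Finset ℕ}

lemma subset_upCompressSet : A ⊆ upCompressSet ℱ i A := by
  unfold upCompressSet
  split_ifs
  · rfl
  · exact subset_insert _ _

lemma upCompressSet_subset : upCompressSet ℱ i A ⊆ insert i A := by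
  unfold upCompressSet
  split_ifs
  · exact subset_insert _ _
  · rfl

lemma upCompressSet_injOn : Set.InjOn (upCompressSet ℱ i) ℱ := by
  intro A hA B hB h
  have hA : A ∈ ℱ := hA
  have hB : B ∈ ℱ := hB
  unfold upCompressSet at h
  split_ifs at h with h1 h2 h2
  · exact h
  · exact absurd (h ▸ hA) h2
  · exact absurd (h ▸ hB) h1
  · have hiA : i ∉ A := fun hi => h1 (by rwa [insert_eq_self.2 hi])
    have hiB : i ∉ B := fun hi => h2 (by rwa [insert_eq_self.2 hi])
    rw [← erase_insert hiA, h, erase_insert hiB]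

lemma insert_mem_image_upCompressSet (hA : A ∈ ℱ) :
    insert i A ∈ ℱ.image (upCompressSet ℱ i) := by
  by_cases h : insert i A ∈ ℱ
  · exact mem_image.2 ⟨insert i A, h, by simp [upCompressSet, h]⟩
  · exact mem_image.2 ⟨A, hA, by simp [upCompressSet, h]⟩

lemma mem_image_upCompressSet (hA : A ∈ ℱ) (hi : insert i A ∈ ℱ) :
    A ∈ ℱ.image (upCompressSet ℱ i) :=
  mem_image.2 ⟨A, hA, by simp [upCompressSet, hi]⟩

lemma of_mem_image_upCompressSet (hA : A ∈ ℱ.image (upCompressSet ℱ i)) :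
    (A ∈ ℱ ∧ insert i A ∈ ℱ) ∨ ∃ B ∈ ℱ, A = insert i B := by
  obtain ⟨B, hB, rfl⟩ := mem_image.1 hA
  unfold upCompressSet
  split_ifs with h
  · exact Or.inl ⟨hB, h⟩
  · exact Or.inr ⟨B, hB, rfl⟩

lemma insert_mem_image_upCompressSet_of_forall {j : ℕ} (hℱ : ∀ A ∈ ℱ, insert j A ∈ ℱ)
    (hA : A ∈ ℱ.image (upCompressSet ℱ i)) : insert j A ∈ ℱ.image (upCompressSet ℱ i) := by
  rcases of_mem_image_upCompressSet hA with ⟨h1, h2⟩ | ⟨B, hB, rfl⟩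
  · exact mem_image_upCompressSet (hℱ _ h1) (by rw [insert_comm]; exact hℱ _ h2)
  · rw [insert_comm]
    exact insert_mem_image_upCompressSet (hℱ _ hB)

lemma insert_self_mem_image_upCompressSet
    (hA : A ∈ ℱ.image (upCompressSet ℱ i)) : insert i A ∈ ℱ.image (upCompressSet ℱ i) := by
  rcases of_mem_image_upCompressSet hA with ⟨h1, -⟩ | ⟨B, hB, rfl⟩
  · exact insert_mem_image_upCompressSet h1
  · rwa [insert_idem]

lemma UnionClosed.image_upCompressSet (hℱ : UnionClosed ℱ) :
    UnionClosed (ℱ.image (upCompressSet ℱ i)) := by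
  intro A hA B hB
  rcases of_mem_image_upCompressSet hA with ⟨h1, h2⟩ | ⟨C, hC, rfl⟩ <;>
    rcases of_mem_image_upCompressSet hB with ⟨h3, h4⟩ | ⟨D, hD, rfl⟩
  · exact mem_image_upCompressSet (hℱ _ h1 _ h3) (by rw [← insert_union]; exact hℱ _ h2 _ h3)
  · rw [union_insert]
    exact insert_mem_image_upCompressSet (hℱ _ h1 _ hD)
  · rw [insert_union]
    exact insert_mem_image_upCompressSet (hℱ _ hC _ h3)
  · rw [insert_union, union_insert, insert_idem]
    exact insert_mem_image_upCompressSet (hℱ _ hC _ hD)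

end UpCompression

/-- Successive up-compressions in the directions of `S` give an injection `g` from a union-closed
family onto a family closed under inserting elements of `S`, such that no interval `[A, g A]`
contains a second member of the original family. -/
lemma UnionClosed.exists_upCompression (S : Finset ℕ) : ∀ (T : Finset ℕ) (ℱ : Finset (Finset ℕ)),
    UnionClosed ℱ → (∀ j ∈ T, ∀ A ∈ ℱ, insert j A ∈ ℱ) →
    ∃ g : Finset ℕ → Finset ℕ, Set.InjOn g ℱ ∧ (∀ A ∈ ℱ, A ⊆ g A) ∧ (∀ A ∈ ℱ, g A ⊆ A ∪ S) ∧
      (∀ j ∈ T ∪ S, ∀ A ∈ ℱ.image g, insert j A ∈ ℱ.image g) ∧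
      ∀ A ∈ ℱ, ∀ B ∈ ℱ, A ⊆ B → B ⊆ g A → B = A := by
  induction S using Finset.induction_on with
  | empty =>
    intro T ℱ _ hT
    exact ⟨id, Set.injOn_id _, fun A _ => subset_rfl, fun A _ => by simp, by simpa using hT,
      fun A _ B _ h1 h2 => h2.antisymm h1⟩
  | insert i S hi ih =>
    intro T ℱ hℱ hT
    obtain ⟨g, hinj, hle, hsub, hins, hiso⟩ := ih (insert i T) (ℱ.image (upCompressSet ℱ i))
      hℱ.image_upCompressSet (by
        intro j hj A hA
        rcases mem_insert.1 hj with rfl | hj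
        · exact insert_self_mem_image_upCompressSet hA
        · exact insert_mem_image_upCompressSet_of_forall (hT j hj) hA)
    have hmem : ∀ A ∈ ℱ, upCompressSet ℱ i A ∈ ℱ.image (upCompressSet ℱ i) :=
      fun A hA => mem_image_of_mem _ hA
    refine ⟨fun A => g (upCompressSet ℱ i A), ?_, ?_, ?_, ?_, ?_⟩
    · intro A hA B hB h
      exact upCompressSet_injOn hA hB (hinj (hmem A hA) (hmem B hB) h)
    · exact fun A hA => subset_upCompressSet.trans (hle _ (hmem A hA))
    · intro A hA
      refine (hsub _ (hmem A hA)).trans ?_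
      rw [union_insert, ← insert_union]
      exact union_subset_union_left upCompressSet_subset
    · rw [show (fun A => g (upCompressSet ℱ i A)) = g ∘ upCompressSet ℱ i from rfl,
        ← image_image, union_insert, ← insert_union]
      exact hins
    · intro A hA B hB hAB hBg
      by_contra hne
      have key : ∀ C ∈ ℱ.image (upCompressSet ℱ i), upCompressSet ℱ i A ⊆ C →
          C ⊆ g (upCompressSet ℱ i A) → C = upCompressSet ℱ i A :=
        fun C hC => hiso _ (hmem A hA) C hC
      by_cases h : insert i A ∈ ℱ
      · have hu : upCompressSet ℱ i A = A := by simp [upCompressSet, h]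
        rw [hu] at key
        refine hne (key B (mem_image_upCompressSet hB ?_) hAB (by simpa [hu] using hBg))
        have := hℱ _ h _ hB
        rwa [insert_union, union_eq_right.2 hAB] at this
      · have hu : upCompressSet ℱ i A = insert i A := by simp [upCompressSet, h]
        have hig : insert i A ⊆ g (insert i A) := by simpa [hu] using hle _ (hmem A hA)
        rw [hu] at key
        have h1 := key (insert i B) (insert_mem_image_upCompressSet hB)
          (insert_subset_insert i hAB)
          (insert_subset (hig (mem_insert_self _ _)) (by simpa [hu] using hBg))
        by_cases hiB : i ∈ B
        · rw [insert_eq_self.2 hiB] at h1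
          exact h (h1 ▸ hB)
        · have hiA : i ∉ A := fun hi => hiB (hAB hi)
          exact hne (by rw [← erase_insert hiB, h1, erase_insert hiA])

lemma two_pow_mul_le_two_pow (d e : ℕ) : (2 : ℤ) ^ e * (1 + d - e) ≤ 2 ^ d := by
  rcases lt_or_ge d e with h | h
  · have h1 : (1 + d - e : ℤ) ≤ 0 := by omega
    have h2 : (0 : ℤ) < 2 ^ e := by positivity
    have h3 : (0 : ℤ) < 2 ^ d := by positivity
    nlinarith
  · obtain ⟨x, rfl⟩ := Nat.exists_eq_add_of_le h
    have h1 : ((x + 1 : ℕ) : ℤ) ≤ ((2 ^ x : ℕ) : ℤ) := Nat.cast_le.2 Nat.lt_two_pow_self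
    push_cast at h1 ⊢
    rw [pow_add]
    apply mul_le_mul_of_nonneg_left _ (by positivity)
    linarith

lemma sum_le_of_sum_two_pow_le {ι : Type*} {s : Finset ι} {f : ι → ℕ} {n N : ℕ} (hn : n ≤ N)
    (h : ∑ a ∈ s, 2 ^ f a ≤ 2 ^ N) :
    (∑ a ∈ s, f a : ℤ) ≤ 2 ^ n - s.card + s.card * (N - n) := by
  obtain ⟨e, rfl⟩ := Nat.exists_eq_add_of_le hn
  have h1 : (2 : ℤ) ^ e * ∑ a ∈ s, (1 + f a - e : ℤ) ≤ 2 ^ e * 2 ^ n := by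
    rw [mul_sum, ← pow_add, add_comm e n]
    refine (sum_le_sum fun a _ => two_pow_mul_le_two_pow (f a) e).trans ?_
    exact_mod_cast h
  have h2 := le_of_mul_le_mul_left h1 (by positivity)
  simp only [sum_sub_distrib, sum_add_distrib, sum_const, nsmul_eq_mul, mul_one] at h2
  push_cast
  linarith

lemma UnionClosed.le_totalSize {𝒜 : Finset (Finset ℕ)} (h𝒜 : UnionClosed 𝒜) {n : ℕ}
    (hlow : 2 ^ n < 2 * 𝒜.card) :
    (n * 𝒜.card - totalSize (colexInit 𝒜.card) - (2 ^ n - 𝒜.card) : ℤ) ≤ totalSize 𝒜 := by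
  set S : Finset ℕ := 𝒜.sup id with hS
  have hAS : ∀ A ∈ 𝒜, A ⊆ S := fun A hA => le_sup (f := id) hA
  obtain ⟨g, hinj, hle, hsub, hins, hiso⟩ := h𝒜.exists_upCompression S ∅ 𝒜 (by simp)
  have hgS : ∀ A ∈ 𝒜, g A ⊆ S := fun A hA => (hsub A hA).trans (union_subset (hAS A hA) subset_rfl)
  have hn : n ≤ S.card := by
    have h1 : 𝒜.card ≤ 2 ^ S.card := by
      rw [← card_powerset]
      exact card_le_card fun A hA => mem_powerset.2 (hAS A hA)
    have h2 : 2 ^ n < 2 ^ (S.card + 1) := by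
      rw [pow_succ]
      omega
    have := (Nat.pow_lt_pow_iff_right (by norm_num : 1 < 2)).1 h2
    omega
  have hdisj : ∑ A ∈ 𝒜, 2 ^ ((g A).card - A.card) ≤ 2 ^ S.card := by
    rw [sum_congr rfl fun A hA => (card_Icc_finset (hle A hA)).symm, ← card_biUnion, ← card_powerset]
    · refine card_le_card fun C hC => ?_
      obtain ⟨A, hA, hC⟩ := mem_biUnion.1 hC
      exact mem_powerset.2 ((mem_Icc.1 hC).2.trans (hgS A hA))
    · intro A hA B hB hne
      refine disjoint_left.2 fun C hC hC' => hne ?_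
      rw [mem_Icc] at hC hC'
      have hU := h𝒜 A hA B hB
      have h1 : A ∪ B ≤ C := union_subset hC.1 hC'.1
      exact (hiso A hA _ hU subset_union_left (h1.trans hC.2)).symm.trans
        (hiso B hB _ hU subset_union_right (h1.trans hC'.2))
  have hsum := sum_le_of_sum_two_pow_le hn hdisj
  set 𝒟 : Finset (Finset ℕ) := 𝒜.image fun A => S \ g A with h𝒟
  have hinj' : Set.InjOn (fun A => S \ g A) 𝒜 := by
    intro A hA B hB h
    apply hinj hA hB
    rw [← Finset.sdiff_sdiff_eq_self (hgS A hA), ← Finset.sdiff_sdiff_eq_self (hgS B hB)]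
    exact congrArg (S \ ·) h
  have hclosed : ∀ R ⊆ S, ∀ X ∈ 𝒜.image g, R ∪ X ∈ 𝒜.image g := by
    intro R
    induction R using Finset.induction_on with
    | empty => simp
    | insert j R _ ih =>
      intro hR X hX
      rw [insert_union]
      exact hins j (by simpa using hR (mem_insert_self _ _)) _
        (ih ((subset_insert _ _).trans hR) X hX)
  have hdown : IsDownSet 𝒟 := by
    intro X hX Y hY
    obtain ⟨A, hA, rfl⟩ := mem_image.1 hX
    obtain ⟨B, hB, hBe⟩ := mem_image.1 (hclosed (S \ Y) sdiff_subset _ (mem_image_of_mem g hA))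
    refine mem_image.2 ⟨B, hB, ?_⟩
    ext x
    have := @hY x
    simp only [hBe, mem_sdiff, mem_union] at this ⊢
    tauto
  have hD := totalSize_le_of_isDownSet S 𝒟 (by
    intro X hX
    obtain ⟨A, -, rfl⟩ := mem_image.1 hX
    exact mem_powerset.2 sdiff_subset) hdown
  rw [card_image_of_injOn hinj', h𝒟, totalSize, sum_image hinj'] at hD
  have htot : (totalSize 𝒜 : ℤ) + ∑ A ∈ 𝒜, (((g A).card - A.card : ℕ) : ℤ)
      + ∑ A ∈ 𝒜, ((S \ g A).card : ℤ) = S.card * 𝒜.card := by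
    rw [totalSize, Nat.cast_sum, ← sum_add_distrib, ← sum_add_distrib, mul_comm, ← nsmul_eq_mul,
      ← sum_const]
    refine sum_congr rfl fun A hA => ?_
    have h1 := card_le_card (hle A hA)
    have h2 := card_sdiff_add_card_eq_card (hgS A hA)
    omega
  have hD' : ∑ A ∈ 𝒜, ((S \ g A).card : ℤ) ≤ totalSize (colexInit 𝒜.card) := by exact_mod_cast hD
  linarith

lemma isDownSet_colexInit (m : ℕ) : IsDownSet (colexInit m) := by
  intro A hA B hB
  obtain ⟨k, hk, rfl⟩ := mem_image.1 hA
  have hB' : B ∈ colexInit (2 ^ k) := by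
    rw [colexInit_two_pow]
    exact mem_powerset.2 (hB.trans (colexSet_subset_Icc Nat.lt_two_pow_self))
  obtain ⟨j, -, rfl⟩ := mem_image.1 hB'
  exact mem_image.2 ⟨j, mem_range.2 ((le_of_colexSet_subset hB).trans_lt (mem_range.1 hk)), rfl⟩

lemma UnionClosed.powerset_sdiff_image_insert {S : Finset ℕ} {𝒟 : Finset (Finset ℕ)} {i : ℕ}
    (h𝒟 : IsDownSet 𝒟) (hi : ∀ A ∈ 𝒟, i ∉ A) :
    UnionClosed (S.powerset \ 𝒟.image (insert i)) := by
  have key : ∀ A B C, C ∈ 𝒟 → insert i C = A ∪ B → i ∈ A → A ∈ 𝒟.image (insert i) := by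
    intro A B C hC h hA
    refine mem_image.2 ⟨A.erase i, h𝒟 C hC _ ?_, insert_erase hA⟩
    rw [← erase_insert (hi C hC), h]
    exact erase_subset_erase i subset_union_left
  intro A hA B hB
  simp only [mem_sdiff, mem_powerset] at hA hB ⊢
  refine ⟨union_subset hA.1 hB.1, fun h => ?_⟩
  obtain ⟨C, hC, h⟩ := mem_image.1 h
  rcases mem_union.1 (h ▸ mem_insert_self i C) with hiA | hiB
  · exact hA.2 (key A B C hC h hiA)
  · exact hB.2 (key B A C hC (by rw [h, union_comm]) hiB)

lemma totalSize_image_insert {𝒟 : Finset (Finset ℕ)} {i : ℕ} (hi : ∀ A ∈ 𝒟, i ∉ A) :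
    (𝒟.image (insert i)).card = 𝒟.card ∧
      totalSize (𝒟.image (insert i)) = totalSize 𝒟 + 𝒟.card := by
  have hinj : Set.InjOn (insert i : Finset ℕ → Finset ℕ) 𝒟 := by
    intro A hA B hB h
    rw [← erase_insert (hi A hA), h, erase_insert (hi B hB)]
  refine ⟨card_image_of_injOn hinj, ?_⟩
  rw [totalSize, sum_image hinj, totalSize, card_eq_sum_ones, ← sum_add_distrib]
  exact sum_congr rfl fun A hA => card_insert_of_notMem (hi A hA)

/-- For `2^{n-1} < m ≤ 2^n` and `m' = 2^n - m`, the minimum of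
`‖𝒜‖` over union-closed families `𝒜` of `m` finite sets of positive integers is
`‖𝒫(n)‖ - ‖I(m')‖ - m'`. -/
theorem stmt0 (m n : ℕ) (hm : 1 ≤ m) (hlow : 2 ^ n < 2 * m) (hhigh : m ≤ 2 ^ n)
    (m' : ℕ) (hm' : m' = 2 ^ n - m) :
    IsLeast {t : ℤ | ∃ 𝒜 : Finset (Finset ℕ), UnionClosed 𝒜 ∧
        (∀ A ∈ 𝒜, ∀ a ∈ A, 1 ≤ a) ∧ 𝒜.card = m ∧ (totalSize 𝒜 : ℤ) = t}
      ((totalSize ((Finset.Icc 1 n).powerset) : ℤ)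
        - (totalSize (colexInit m') : ℤ) - (m' : ℤ)) := by
  have hm2 : m + m' = 2 ^ n := by omega
  constructor
  · have hlt : ∀ A ∈ colexInit m', A ⊆ Icc 1 (n - 1) := by
      intro A hA
      obtain ⟨k, hk, rfl⟩ := mem_image.1 hA
      apply colexSet_subset_Icc
      rw [mem_range] at hk
      rcases n with _ | n
      · simp at hm2
        omega
      · rw [pow_succ] at hlow hm2
        simp only [Nat.add_sub_cancel]
        omega
    have hnot : ∀ A ∈ colexInit m', n ∉ A := by
      intro A hA h
      have := mem_Icc.1 (hlt A hA h)
      omega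
    have hsub : (colexInit m').image (insert n) ⊆ (Icc 1 n).powerset := by
      intro X hX
      obtain ⟨A, hA, rfl⟩ := mem_image.1 hX
      have hn : 1 ≤ n := by
        rcases n with _ | n
        · have := card_pos.2 ⟨A, hA⟩
          rw [card_colexInit] at this
          simp at hm2
          omega
        · omega
      exact mem_powerset.2 (insert_subset (mem_Icc.2 ⟨hn, le_rfl⟩)
        ((hlt A hA).trans (Icc_subset_Icc le_rfl (Nat.sub_le n 1))))
    obtain ⟨hc, ht⟩ := totalSize_image_insert hnot
    rw [card_colexInit] at hc ht
    refine ⟨(Icc 1 n).powerset \ (colexInit m').image (insert n),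
      .powerset_sdiff_image_insert (isDownSet_colexInit m') hnot, ?_, ?_, ?_⟩
    · intro A hA a ha
      exact (mem_Icc.1 (mem_powerset.1 (mem_sdiff.1 hA).1 ha)).1
    · rw [card_sdiff_of_subset hsub, hc, card_powerset, Nat.card_Icc, Nat.add_sub_cancel]
      omega
    · have : totalSize ((Icc 1 n).powerset \ (colexInit m').image (insert n))
          + totalSize ((colexInit m').image (insert n)) = totalSize (Icc 1 n).powerset :=
        sum_sdiff hsub
      omega
  · rintro _ ⟨𝒜, h𝒜, -, rfl, rfl⟩
    have h1 := h𝒜.le_totalSize hlow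
    have h2 := totalSize_colexInit_two_pow_sub hhigh
    rw [← hm', colexInit_two_pow] at h2
    zify at h2 hm2
    linarith
end

section
/- If 𝒜 ⊆ 𝒫(n) is a union-closed family with |𝒜| ≥ (2/3)·2^n and 𝒜 ≠ {∅}, then there exists i ∈ [n] such that |{A ∈ 𝒜 : i ∈ A}| ≥ |𝒜|/2. -/
open Finset
open scoped Classical

/-- The discrete derivative of `g` in direction `i`. -/
def discreteDeriv (g : Finset ℕ → ℚ) (i : ℕ) (A : Finset ℕ) : ℚ :=
  g (insert i A) - g (A.erase i)

/-- The unnormalized total influence of `g` on the cube of subsets of `s`. -/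
def totalInfluence (s : Finset ℕ) (g : Finset ℕ → ℚ) : ℚ :=
  ∑ i ∈ s, ∑ A ∈ s.powerset, discreteDeriv g i A ^ 2

/-- The unnormalized Fourier weight of `g` at level one on the cube of subsets of `s`. -/
def levelOneWeight (s : Finset ℕ) (g : Finset ℕ → ℚ) : ℚ :=
  ∑ i ∈ s, (∑ A ∈ s.powerset, discreteDeriv g i A) ^ 2

lemma discreteDeriv_add (g h : Finset ℕ → ℚ) (i : ℕ) (A : Finset ℕ) :
    discreteDeriv (fun A => g A + h A) i A = discreteDeriv g i A + discreteDeriv h i A := by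
  simp only [discreteDeriv]; ring

lemma discreteDeriv_sub (g h : Finset ℕ → ℚ) (i : ℕ) (A : Finset ℕ) :
    discreteDeriv (fun A => g A - h A) i A = discreteDeriv g i A - discreteDeriv h i A := by
  simp only [discreteDeriv]; ring

lemma discreteDeriv_insert_of_ne (g : Finset ℕ → ℚ) {a i : ℕ} (h : a ≠ i) (A : Finset ℕ) :
    discreteDeriv g i (insert a A) = discreteDeriv (fun A => g (insert a A)) i A := by
  simp only [discreteDeriv]
  rw [Finset.insert_comm, Finset.erase_insert_of_ne h]

lemma discreteDeriv_self_of_notMem (g : Finset ℕ → ℚ) {a : ℕ} {A : Finset ℕ} (h : a ∉ A) :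
    discreteDeriv g a A = g (insert a A) - g A := by
  simp [discreteDeriv, h]

lemma discreteDeriv_self_insert (g : Finset ℕ → ℚ) {a : ℕ} {A : Finset ℕ} (h : a ∉ A) :
    discreteDeriv g a (insert a A) = g (insert a A) - g A := by
  simp [discreteDeriv, h]

lemma totalInfluence_insert {a : ℕ} {s : Finset ℕ} (ha : a ∉ s) (g : Finset ℕ → ℚ) :
    totalInfluence (insert a s) g =
      totalInfluence s g + totalInfluence s (fun A => g (insert a A)) +
        2 * ∑ A ∈ s.powerset, (g (insert a A) - g A) ^ 2 := by
  have key : ∀ A ∈ s.powerset, a ∉ A := fun A hA h => ha (Finset.mem_powerset.1 hA h)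
  have h1 : ∑ A ∈ s.powerset, discreteDeriv g a A ^ 2 =
      ∑ A ∈ s.powerset, (g (insert a A) - g A) ^ 2 :=
    Finset.sum_congr rfl fun A hA => by rw [discreteDeriv_self_of_notMem g (key A hA)]
  have h2 : ∑ A ∈ s.powerset, discreteDeriv g a (insert a A) ^ 2 =
      ∑ A ∈ s.powerset, (g (insert a A) - g A) ^ 2 :=
    Finset.sum_congr rfl fun A hA => by rw [discreteDeriv_self_insert g (key A hA)]
  have h3 : ∑ i ∈ s, ∑ A ∈ s.powerset, discreteDeriv g i (insert a A) ^ 2 =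
      totalInfluence s (fun A => g (insert a A)) :=
    Finset.sum_congr rfl fun i hi => Finset.sum_congr rfl fun A _ => by
      rw [discreteDeriv_insert_of_ne g (ne_of_mem_of_not_mem hi ha).symm]
  rw [totalInfluence, Finset.sum_insert ha]
  simp only [Finset.sum_powerset_insert ha, Finset.sum_add_distrib]
  rw [h1, h2, h3, ← totalInfluence]
  ring

lemma levelOneWeight_insert {a : ℕ} {s : Finset ℕ} (ha : a ∉ s) (g : Finset ℕ → ℚ) :
    levelOneWeight (insert a s) g =
      levelOneWeight s (fun A => g (insert a A) + g A) +
        4 * (∑ A ∈ s.powerset, (g (insert a A) - g A)) ^ 2 := by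
  have key : ∀ A ∈ s.powerset, a ∉ A := fun A hA h => ha (Finset.mem_powerset.1 hA h)
  have h1 : ∑ A ∈ s.powerset, discreteDeriv g a A =
      ∑ A ∈ s.powerset, (g (insert a A) - g A) :=
    Finset.sum_congr rfl fun A hA => by rw [discreteDeriv_self_of_notMem g (key A hA)]
  have h2 : ∑ A ∈ s.powerset, discreteDeriv g a (insert a A) =
      ∑ A ∈ s.powerset, (g (insert a A) - g A) :=
    Finset.sum_congr rfl fun A hA => by rw [discreteDeriv_self_insert g (key A hA)]
  have h3 : ∑ i ∈ s, (∑ A ∈ s.powerset, discreteDeriv g i A +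
        ∑ A ∈ s.powerset, discreteDeriv g i (insert a A)) ^ 2 =
      levelOneWeight s (fun A => g (insert a A) + g A) :=
    Finset.sum_congr rfl fun i hi => by
      rw [← Finset.sum_add_distrib]
      congr 1
      refine Finset.sum_congr rfl fun A _ => ?_
      rw [discreteDeriv_add, discreteDeriv_insert_of_ne g (ne_of_mem_of_not_mem hi ha).symm, add_comm]
  rw [levelOneWeight, Finset.sum_insert ha]
  simp only [Finset.sum_powerset_insert ha]
  rw [h1, h2, h3]
  ring

lemma totalInfluence_add_add_totalInfluence_sub (s : Finset ℕ) (g h : Finset ℕ → ℚ) :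
    totalInfluence s (fun A => g A + h A) + totalInfluence s (fun A => g A - h A) =
      2 * (totalInfluence s g + totalInfluence s h) := by
  simp only [totalInfluence, Finset.mul_sum, ← Finset.sum_add_distrib]
  refine Finset.sum_congr rfl fun i _ => Finset.sum_congr rfl fun A _ => ?_
  rw [discreteDeriv_add, discreteDeriv_sub]
  ring

/-- The Poincaré inequality on the discrete cube. -/
lemma poincare_powerset (s : Finset ℕ) (g : Finset ℕ → ℚ) :
    4 * (2 ^ s.card * ∑ A ∈ s.powerset, g A ^ 2 - (∑ A ∈ s.powerset, g A) ^ 2) ≤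
      2 ^ s.card * totalInfluence s g := by
  induction s using Finset.induction_on generalizing g with
  | empty => simp [totalInfluence]
  | insert a s ha ih =>
    have h0 := ih g
    have h1 := ih fun A => g (insert a A)
    have hcs := sq_sum_le_card_mul_sum_sq (s := s.powerset) (f := fun A => g (insert a A) - g A)
    rw [Finset.card_powerset, Finset.sum_sub_distrib] at hcs
    push_cast at hcs
    rw [totalInfluence_insert ha, Finset.card_insert_of_notMem ha,
      Finset.sum_powerset_insert ha, Finset.sum_powerset_insert ha, pow_succ]
    linear_combination 2 * h0 + 2 * h1 + 4 * hcs

/-- The Poincaré inequality on the discrete cube, improved by the weight at level one: all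
Fourier levels from the second on contribute at least twice to the total influence. -/
lemma poincare_powerset_levelOne (s : Finset ℕ) (g : Finset ℕ → ℚ) :
    8 * (2 ^ s.card * ∑ A ∈ s.powerset, g A ^ 2 - (∑ A ∈ s.powerset, g A) ^ 2) ≤
      2 ^ s.card * totalInfluence s g + levelOneWeight s g := by
  induction s using Finset.induction_on generalizing g with
  | empty => simp [totalInfluence, levelOneWeight]
  | insert a s ha ih =>
    have h0 := ih fun A => g (insert a A) + g A
    have h1 := poincare_powerset s fun A => g (insert a A) - g A
    have hinf := totalInfluence_add_add_totalInfluence_sub s (fun A => g (insert a A)) g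
    have hsq : ∑ A ∈ s.powerset, (g (insert a A) + g A) ^ 2 +
        ∑ A ∈ s.powerset, (g (insert a A) - g A) ^ 2 =
        2 * (∑ A ∈ s.powerset, g A ^ 2 + ∑ A ∈ s.powerset, g (insert a A) ^ 2) := by
      simp only [Finset.mul_sum, ← Finset.sum_add_distrib]
      exact Finset.sum_congr rfl fun A _ => by ring
    rw [Finset.sum_add_distrib (f := fun A => g (insert a A))] at h0
    rw [totalInfluence_insert ha, levelOneWeight_insert ha, Finset.card_insert_of_notMem ha,
      Finset.sum_powerset_insert ha, Finset.sum_powerset_insert ha, pow_succ]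
    linear_combination h0 + h1 + 2 ^ s.card * hinf - 8 * 2 ^ s.card * hsq

lemma sum_powerset_eq_sum_powerset_erase {s : Finset ℕ} {i : ℕ} (hi : i ∈ s)
    (F : Finset ℕ → ℚ) :
    ∑ A ∈ s.powerset, F A = ∑ A ∈ (s.erase i).powerset, (F A + F (insert i A)) := by
  conv_lhs => rw [← Finset.insert_erase hi]
  rw [Finset.sum_powerset_insert (Finset.notMem_erase i s), Finset.sum_add_distrib]

/-- A set outside a union-closed family covers at most one member of the family. -/
lemma UnionClosed.card_filter_erase_mem_le_one {𝒜 : Finset (Finset ℕ)} (huc : UnionClosed 𝒜)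
    {B : Finset ℕ} (hB : B ∉ 𝒜) : (B.filter fun i => B.erase i ∈ 𝒜).card ≤ 1 := by
  rw [Finset.card_le_one]
  intro i hi j hj
  rw [Finset.mem_filter] at hi hj
  by_contra hij
  refine hB ?_
  have hu : B.erase i ∪ B.erase j = B := by
    ext x
    simp only [Finset.mem_union, Finset.mem_erase]
    grind
  exact hu ▸ huc _ hi.2 _ hj.2

/-- The edges of the cube leaving a union-closed family upwards are at most as many as the sets
outside the family; each edge is counted once for each of its endpoints. -/
lemma UnionClosed.sum_upper_boundary_le {𝒜 : Finset (Finset ℕ)} (huc : UnionClosed 𝒜)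
    (s : Finset ℕ) :
    ∑ i ∈ s, ∑ A ∈ s.powerset, (if insert i A ∉ 𝒜 ∧ A.erase i ∈ 𝒜 then (1 : ℚ) else 0) ≤
      2 * (s.powerset \ 𝒜).card := by
  have h1 : ∀ i ∈ s,
      ∑ A ∈ s.powerset, (if insert i A ∉ 𝒜 ∧ A.erase i ∈ 𝒜 then (1 : ℚ) else 0) =
        2 * ∑ B ∈ s.powerset, (if i ∈ B ∧ B ∉ 𝒜 ∧ B.erase i ∈ 𝒜 then (1 : ℚ) else 0) := by
    intro i hi
    rw [sum_powerset_eq_sum_powerset_erase hi, sum_powerset_eq_sum_powerset_erase hi,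
      Finset.mul_sum]
    refine Finset.sum_congr rfl fun A hA => ?_
    have hiA : i ∉ A := fun h => Finset.notMem_erase i s (Finset.mem_powerset.1 hA h)
    simp only [Finset.insert_idem, Finset.erase_insert hiA, Finset.erase_eq_of_notMem hiA,
      hiA, Finset.mem_insert_self, true_and, false_and, if_false]
    ring
  rw [Finset.sum_congr rfl h1, ← Finset.mul_sum, Finset.sum_comm]
  refine mul_le_mul_of_nonneg_left ?_ (by norm_num)
  rw [Finset.card_eq_sum_ones, ← Finset.filter_notMem_eq_sdiff, Finset.sum_filter]
  push_cast
  refine Finset.sum_le_sum fun B hB => ?_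
  by_cases hBA : B ∈ 𝒜
  · simp [hBA]
  · rw [if_pos hBA, Finset.sum_boole]
    have hle : (s.filter fun i => i ∈ B ∧ B ∉ 𝒜 ∧ B.erase i ∈ 𝒜).card ≤ 1 := by
      refine (Finset.card_le_card ?_).trans (huc.card_filter_erase_mem_le_one hBA)
      intro i hi
      simp only [Finset.mem_filter] at hi ⊢
      exact ⟨hi.2.1, hi.2.2.2⟩
    exact_mod_cast hle

lemma sum_discreteDeriv_indicator {s : Finset ℕ} {𝒜 : Finset (Finset ℕ)}
    (hsub : 𝒜 ⊆ s.powerset) {i : ℕ} (hi : i ∈ s) :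
    ∑ A ∈ s.powerset, discreteDeriv (fun A => if A ∈ 𝒜 then 1 else 0) i A =
      2 * (2 * ((𝒜.filter fun A => i ∈ A).card : ℚ) - 𝒜.card) := by
  have hcard : (𝒜.card : ℚ) = ∑ A ∈ s.powerset, if A ∈ 𝒜 then (1 : ℚ) else 0 := by
    rw [Finset.sum_boole, Finset.filter_mem_eq_inter, Finset.inter_eq_right.2 hsub]
  have hdeg : ((𝒜.filter fun A => i ∈ A).card : ℚ) =
      ∑ A ∈ s.powerset, if A ∈ 𝒜 ∧ i ∈ A then (1 : ℚ) else 0 := by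
    rw [Finset.sum_boole, ← Finset.filter_filter, Finset.filter_mem_eq_inter,
      Finset.inter_eq_right.2 hsub]
  rw [hcard, hdeg]
  simp only [sum_powerset_eq_sum_powerset_erase hi, Finset.mul_sum, ← Finset.sum_sub_distrib]
  refine Finset.sum_congr rfl fun A hA => ?_
  have hiA : i ∉ A := fun h => Finset.notMem_erase i s (Finset.mem_powerset.1 hA h)
  rw [discreteDeriv_self_of_notMem _ hiA, discreteDeriv_self_insert _ hiA]
  simp only [hiA, and_false, if_false, Finset.mem_insert_self, and_true]
  ring

/-- A union-closed family in which every element has degree at most half of the size contains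
at most half of the cube, or all of it. -/
lemma UnionClosed.card_mul_card_sdiff_le {s : Finset ℕ} {𝒜 : Finset (Finset ℕ)}
    (huc : UnionClosed 𝒜) (hsub : 𝒜 ⊆ s.powerset)
    (hdeg : ∀ i ∈ s, 2 * ((𝒜.filter fun A => i ∈ A).card : ℚ) ≤ 𝒜.card) :
    2 * (𝒜.card : ℚ) * (s.powerset \ 𝒜).card ≤ 2 ^ s.card * (s.powerset \ 𝒜).card := by
  set g : Finset ℕ → ℚ := fun A => if A ∈ 𝒜 then 1 else 0 with hg
  have hN : (0 : ℚ) < 2 ^ s.card := by positivity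
  have hsum : ∑ A ∈ s.powerset, g A = 𝒜.card := by
    rw [hg, Finset.sum_boole, Finset.filter_mem_eq_inter, Finset.inter_eq_right.2 hsub]
  have hsq : ∑ A ∈ s.powerset, g A ^ 2 = 𝒜.card := by
    rw [← hsum]
    exact Finset.sum_congr rfl fun A _ => by simp only [hg]; split_ifs <;> norm_num
  have hcompl : ((s.powerset \ 𝒜).card : ℚ) = 2 ^ s.card - 𝒜.card := by
    rw [Finset.cast_card_sdiff hsub, Finset.card_powerset]
    push_cast
    ring
  have hpoin := poincare_powerset_levelOne s g
  rw [hsum, hsq] at hpoin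
  have hdir : ∀ i ∈ s, 2 ^ s.card * ∑ A ∈ s.powerset, discreteDeriv g i A ^ 2 +
      (∑ A ∈ s.powerset, discreteDeriv g i A) ^ 2 ≤
      2 ^ s.card * (2 * ∑ A ∈ s.powerset,
        (if insert i A ∉ 𝒜 ∧ A.erase i ∈ 𝒜 then (1 : ℚ) else 0)) := by
    intro i hi
    have hneg : ∑ A ∈ s.powerset, discreteDeriv g i A ≤ 0 := by
      rw [hg, sum_discreteDeriv_indicator hsub hi]
      linarith [hdeg i hi]
    have hlow : -2 ^ s.card ≤ ∑ A ∈ s.powerset, discreteDeriv g i A := by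
      have h := Finset.card_nsmul_le_sum s.powerset (discreteDeriv g i) (-1) fun A _ => by
        simp only [discreteDeriv, hg]
        split_ifs <;> norm_num
      rw [Finset.card_powerset, nsmul_eq_mul] at h
      push_cast at h
      linarith
    have hpt : ∑ A ∈ s.powerset, discreteDeriv g i A ^ 2 -
        ∑ A ∈ s.powerset, discreteDeriv g i A =
        2 * ∑ A ∈ s.powerset, (if insert i A ∉ 𝒜 ∧ A.erase i ∈ 𝒜 then (1 : ℚ) else 0) := by
      rw [← Finset.sum_sub_distrib, Finset.mul_sum]
      refine Finset.sum_congr rfl fun A _ => ?_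
      by_cases h1 : insert i A ∈ 𝒜 <;> by_cases h2 : A.erase i ∈ 𝒜 <;>
        simp [discreteDeriv, hg, h1, h2] <;> norm_num
    rw [← hpt]
    nlinarith
  have htot := Finset.sum_le_sum hdir
  rw [Finset.sum_add_distrib, ← Finset.mul_sum, ← Finset.mul_sum, ← Finset.mul_sum] at htot
  have hup := mul_le_mul_of_nonneg_left (huc.sum_upper_boundary_le s) hN.le
  rw [totalInfluence, levelOneWeight] at hpoin
  rw [hcompl] at hup ⊢
  linarith

/-- The union-closed conjecture holds for union-closed families
`𝒜 ⊆ 𝒫(n)` with `|𝒜| ≥ (2/3)·2^n`. -/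
theorem stmt1 (n : ℕ) (𝒜 : Finset (Finset ℕ)) (hsub : 𝒜 ⊆ (Finset.Icc 1 n).powerset)
    (huc : UnionClosed 𝒜) (hcard : (2 / 3 : ℚ) * 2 ^ n ≤ (𝒜.card : ℚ))
    (hne : 𝒜 ≠ {∅}) :
    ∃ i ∈ Finset.Icc 1 n,
      (𝒜.card : ℚ) / 2 ≤ ((𝒜.filter fun A => i ∈ A).card : ℚ) := by
  by_contra! hlt
  have hdeg : ∀ i ∈ Finset.Icc 1 n, 2 * ((𝒜.filter fun A => i ∈ A).card : ℚ) ≤ 𝒜.card :=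
    fun i hi => by linarith [hlt i hi]
  have hmain := huc.card_mul_card_sdiff_le hsub hdeg
  have hN : (0 : ℚ) < 2 ^ n := by positivity
  rw [Nat.card_Icc, Nat.add_sub_cancel] at hmain
  have hfull : (Finset.Icc 1 n).powerset \ 𝒜 = ∅ := by
    rw [← Finset.card_eq_zero]
    by_contra h
    have hpos : (0 : ℚ) < ((Finset.Icc 1 n).powerset \ 𝒜).card := by
      exact_mod_cast Nat.pos_of_ne_zero h
    have := le_of_mul_le_mul_right hmain hpos
    linarith
  have heq : 𝒜 = (Finset.Icc 1 n).powerset :=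
    hsub.antisymm (Finset.sdiff_eq_empty_iff_subset.1 hfull)
  rcases Nat.eq_zero_or_pos n with rfl | hn
  · exact hne (by simpa using heq)
  · have h1 : 1 ∈ Finset.Icc 1 n := Finset.mem_Icc.2 ⟨le_rfl, hn⟩
    have hneg := hlt 1 h1
    have hzero : ∑ A ∈ (Finset.Icc 1 n).powerset,
        discreteDeriv (fun A => if A ∈ 𝒜 then 1 else 0) 1 A = 0 := by
      refine Finset.sum_eq_zero fun A hA => ?_
      have hA' := Finset.mem_powerset.1 hA
      have hi : insert 1 A ∈ 𝒜 := by
        rw [heq]; exact Finset.mem_powerset.2 (Finset.insert_subset h1 hA')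
      have he : A.erase 1 ∈ 𝒜 := by
        rw [heq]; exact Finset.mem_powerset.2 ((Finset.erase_subset _ _).trans hA')
      simp [discreteDeriv, hi, he]
    rw [sum_discreteDeriv_indicator hsub h1] at hzero
    linarith
end

section
/- If 𝒜 ⊆ 𝒫(n) is a counterexample to the union-closed conjecture, and ℬ = 𝒫(n) ∖ 𝒜 with |ℬ| = m, then ‖I(m)‖ > m(n/2 − 1 + 1/24). -/
open Finset
open scoped Classical

/-- The total size of the colex initial segment of length `m`, as a sum of binary digit sums. -/
def colexSize (m : ℕ) : ℕ := ∑ k ∈ Finset.range m, k.bitIndices.length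

lemma colexSet_eq (k : ℕ) : colexSet k = k.bitIndices.toFinset.image (· + 1) := by
  unfold colexSet
  congr 1
  ext i
  simp only [Finset.mem_filter, Finset.mem_range, List.mem_toFinset, Nat.mem_bitIndices,
    and_iff_right_iff_imp]
  intro hi
  exact Nat.lt_succ_of_lt (Nat.lt_two_pow_self.trans_le (Nat.ge_two_pow_of_testBit hi))

lemma card_colexSet (k : ℕ) : (colexSet k).card = k.bitIndices.length := by
  rw [colexSet_eq, Finset.card_image_of_injective _ (add_left_injective 1),
    List.toFinset_card_of_nodup Nat.bitIndices_nodup]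

lemma totalSize_colexInit_s2 (m : ℕ) : totalSize (colexInit m) = colexSize m := by
  unfold totalSize colexInit colexSize
  rw [Finset.sum_image fun a _ b _ h => colexSet_injective h]
  exact Finset.sum_congr rfl fun k _ => card_colexSet k

lemma colexSize_two_mul (m : ℕ) : colexSize (2 * m) = 2 * colexSize m + m := by
  induction m with
  | zero => rfl
  | succ m ih =>
    unfold colexSize at *
    rw [show 2 * (m + 1) = 2 * m + 1 + 1 by ring, Finset.sum_range_succ, Finset.sum_range_succ, ih,
      Finset.sum_range_succ]
    simp
    ring

lemma colexSize_two_mul_add_one (m : ℕ) :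
    colexSize (2 * m + 1) = colexSize m + colexSize (m + 1) + m := by
  have h := colexSize_two_mul m
  unfold colexSize at *
  rw [Finset.sum_range_succ, h, Finset.sum_range_succ]
  simp
  ring

lemma colexSize_add_le (a b : ℕ) :
    colexSize a + colexSize b + min a b ≤ colexSize (a + b) := by
  induction h : a + b using Nat.strong_induction_on generalizing a b with
  | _ n ih =>
    subst h
    by_cases hsmall : a + b ≤ 1
    · obtain ⟨rfl, h⟩ | ⟨rfl, h⟩ : (a = 0 ∧ b ≤ 1) ∨ (b = 0 ∧ a ≤ 1) := by omega
      · simp [colexSize]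
      · simp [colexSize]
    obtain ⟨x, rfl | rfl⟩ := Nat.even_or_odd' a <;> obtain ⟨y, rfl | rfl⟩ := Nat.even_or_odd' b
    · have h := ih (x + y) (by omega) x y rfl
      rw [← mul_add, colexSize_two_mul, colexSize_two_mul, colexSize_two_mul]
      omega
    · have h1 := ih (x + y) (by omega) x y rfl
      have h2 := ih (x + (y + 1)) (by omega) x (y + 1) rfl
      rw [show 2 * x + (2 * y + 1) = 2 * (x + y) + 1 by ring, colexSize_two_mul,
        colexSize_two_mul_add_one, colexSize_two_mul_add_one]
      rw [← add_assoc] at h2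
      omega
    · have h1 := ih (x + y) (by omega) x y rfl
      have h2 := ih (x + 1 + y) (by omega) (x + 1) y rfl
      rw [show 2 * x + 1 + 2 * y = 2 * (x + y) + 1 by ring, colexSize_two_mul,
        colexSize_two_mul_add_one, colexSize_two_mul_add_one]
      rw [show x + 1 + y = x + y + 1 by ring] at h2
      omega
    · have h1 := ih (x + (y + 1)) (by omega) x (y + 1) rfl
      have h2 := ih (x + 1 + y) (by omega) (x + 1) y rfl
      rw [show 2 * x + 1 + (2 * y + 1) = 2 * (x + y + 1) by ring, colexSize_two_mul,
        colexSize_two_mul_add_one, colexSize_two_mul_add_one]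
      rw [show x + 1 + y = x + y + 1 by ring] at h2
      rw [← add_assoc] at h1
      omega

lemma length_bitIndices_two_pow_add {k j : ℕ} (hj : j < 2 ^ k) :
    (2 ^ k + j).bitIndices.length = j.bitIndices.length + 1 := by
  induction k generalizing j with
  | zero =>
    obtain rfl : j = 0 := by simpa using hj
    simp
  | succ k ih =>
    rw [pow_succ] at hj ⊢
    obtain ⟨t, rfl | rfl⟩ := Nat.even_or_odd' j
    · have h := ih (j := t) (by omega)
      rw [show 2 ^ k * 2 + 2 * t = 2 * (2 ^ k + t) by ring]
      simpa using h
    · have h := ih (j := t) (by omega)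
      rw [show 2 ^ k * 2 + (2 * t + 1) = 2 * (2 ^ k + t) + 1 by ring]
      simpa using h

lemma colexSize_two_pow_add {k j : ℕ} (hj : j ≤ 2 ^ k) :
    colexSize (2 ^ k + j) = colexSize (2 ^ k) + colexSize j + j := by
  induction j with
  | zero => simp [colexSize]
  | succ j ih =>
    have h := ih (by omega)
    have h' := length_bitIndices_two_pow_add (k := k) (j := j) (by omega)
    unfold colexSize at *
    rw [← add_assoc, Finset.sum_range_succ, h, h', Finset.sum_range_succ]
    ring

lemma two_mul_colexSize_le {k m : ℕ} (hm : m ≤ 2 ^ k) : 2 * colexSize m ≤ m * k := by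
  induction k generalizing m with
  | zero =>
    obtain rfl | rfl : m = 0 ∨ m = 1 := by
      have : m ≤ 1 := by simpa using hm
      omega
    all_goals simp [colexSize]
  | succ k ih =>
    obtain h | h := le_total m (2 ^ k)
    · exact (ih h).trans (Nat.mul_le_mul_left _ (Nat.le_succ k))
    · obtain ⟨j, rfl⟩ := Nat.exists_eq_add_of_le h
      have hj : j ≤ 2 ^ k := by rw [pow_succ] at hm; omega
      have h1 := ih le_rfl
      have h2 := ih hj
      rw [colexSize_two_pow_add hj]
      nlinarith

/-- Below density `1/3`, the average size in a colex initial segment is at most `n / 2 - 1`. -/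
lemma two_mul_colexSize_add_le {n m : ℕ} (hm : 3 * m ≤ 2 ^ n) :
    2 * colexSize m + 2 * m ≤ m * n := by
  induction n using Nat.twoStepInduction generalizing m with
  | zero => obtain rfl : m = 0 := by omega
            simp [colexSize]
  | one => obtain rfl : m = 0 := by omega
           simp [colexSize]
  | more n ih _ =>
    rw [pow_add] at hm
    obtain h | h := le_total m (2 ^ n)
    · have := two_mul_colexSize_le h
      rw [mul_add]
      omega
    · obtain ⟨j, rfl⟩ := Nat.exists_eq_add_of_le h
      have h1 := two_mul_colexSize_le (k := n) le_rfl
      have h2 := ih (m := j) (by omega)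
      rw [colexSize_two_pow_add (by omega)]
      nlinarith

/-- The number of pairs `C, C \ {x}` both lying in the family. -/
def cubeEdges (ℬ : Finset (Finset ℕ)) : ℕ := ∑ C ∈ ℬ, (C.filter fun x => C.erase x ∈ ℬ).card

lemma sum_eq_sum_memberSubfamily_add (ℬ : Finset (Finset ℕ)) (a : ℕ) (g : Finset ℕ → ℕ) :
    ∑ C ∈ ℬ, g C =
      ∑ C ∈ ℬ.memberSubfamily a, g (insert a C) + ∑ C ∈ ℬ.nonMemberSubfamily a, g C := by
  rw [← Finset.sum_filter_add_sum_filter_not ℬ (fun C => a ∈ C),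
    ← Finset.image_insert_memberSubfamily, Finset.sum_image]
  · rfl
  · intro s hs t ht h
    simp only [Finset.mem_coe, Finset.mem_memberSubfamily] at hs ht
    rw [← Finset.erase_insert hs.2, h, Finset.erase_insert ht.2]

lemma cubeEdges_eq (ℬ : Finset (Finset ℕ)) (a : ℕ) :
    cubeEdges ℬ = cubeEdges (ℬ.memberSubfamily a) + cubeEdges (ℬ.nonMemberSubfamily a) +
      (ℬ.memberSubfamily a ∩ ℬ.nonMemberSubfamily a).card := by
  have h1 : ∀ C ∈ ℬ.memberSubfamily a,
      ((insert a C).filter fun x => (insert a C).erase x ∈ ℬ).card =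
        (C.filter fun x => C.erase x ∈ ℬ.memberSubfamily a).card +
          if C ∈ ℬ.nonMemberSubfamily a then 1 else 0 := by
    intro C hC
    rw [Finset.mem_memberSubfamily] at hC
    rw [Finset.filter_insert, Finset.erase_insert hC.2]
    have h2 : (C.filter fun x => (insert a C).erase x ∈ ℬ) =
        C.filter fun x => C.erase x ∈ ℬ.memberSubfamily a := by
      refine Finset.filter_congr fun x hx => ?_
      have hxa : a ≠ x := fun h => hC.2 (h ▸ hx)
      rw [Finset.mem_memberSubfamily, Finset.erase_insert_of_ne hxa]
      simp [hC.2]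
    rw [h2]
    simp only [Finset.mem_nonMemberSubfamily, hC.2, not_false_eq_true, and_true]
    split_ifs with h
    · rw [Finset.card_insert_of_notMem]
      simp [hC.2]
    · simp
  have h2 : ∀ C ∈ ℬ.nonMemberSubfamily a, (C.filter fun x => C.erase x ∈ ℬ).card =
      (C.filter fun x => C.erase x ∈ ℬ.nonMemberSubfamily a).card := by
    intro C hC
    rw [Finset.mem_nonMemberSubfamily] at hC
    congr 1
    refine Finset.filter_congr fun x _ => ?_
    simp [Finset.mem_nonMemberSubfamily, hC.2]
  unfold cubeEdges
  rw [sum_eq_sum_memberSubfamily_add ℬ a, Finset.sum_congr rfl h1, Finset.sum_congr rfl h2,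
    Finset.sum_add_distrib, ← Finset.sum_filter, Finset.sum_const, smul_eq_mul, mul_one,
    Finset.filter_mem_eq_inter]
  ring

/-- The edge-isoperimetric inequality in the discrete cube. -/
lemma cubeEdges_le_colexSize (ℬ : Finset (Finset ℕ)) : cubeEdges ℬ ≤ colexSize ℬ.card := by
  induction ℬ using Finset.memberFamily_induction_on with
  | empty => simp [cubeEdges]
  | singleton_empty => simp [cubeEdges]
  | subfamily a h0 h1 =>
    rename_i ℬ
    rw [cubeEdges_eq ℬ a, ← Finset.card_memberSubfamily_add_card_nonMemberSubfamily a ℬ]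
    have h := colexSize_add_le (ℬ.memberSubfamily a).card (ℬ.nonMemberSubfamily a).card
    have h' : (ℬ.memberSubfamily a ∩ ℬ.nonMemberSubfamily a).card ≤
        min (ℬ.memberSubfamily a).card (ℬ.nonMemberSubfamily a).card :=
      le_min (Finset.card_le_card Finset.inter_subset_left)
        (Finset.card_le_card Finset.inter_subset_right)
    omega

lemma totalSize_le_colexSize {𝒟 : Finset (Finset ℕ)} (h : ∀ C ∈ 𝒟, ∀ k ∈ C, C.erase k ∈ 𝒟) :
    totalSize 𝒟 ≤ colexSize 𝒟.card := by
  refine le_trans (le_of_eq ?_) (cubeEdges_le_colexSize 𝒟)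
  refine Finset.sum_congr rfl fun C hC => ?_
  rw [Finset.filter_true_of_mem fun k hk => h C hC k hk]

section Rooted

variable {ℬ X : Finset (Finset ℕ)} {B C : Finset ℕ} {J S V : Finset ℕ} {b i j : ℕ}

lemma RootedAt.mem (h : RootedAt ℬ B i) : B ∈ ℬ :=
  h.2 B (Finset.singleton_subset_iff.2 h.1) subset_rfl

lemma RootedAt.mono (h : RootedAt ℬ B i) (hi : i ∈ C) (hC : C ⊆ B) : RootedAt ℬ C i :=
  ⟨hi, fun _ h1 h2 => h.2 _ h1 (h2.trans hC)⟩

lemma RootedAt.erase_mem (h : RootedAt ℬ B i) (hj : j ≠ i) : B.erase j ∈ ℬ :=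
  (h.mono (Finset.mem_erase.2 ⟨hj.symm, h.1⟩) (Finset.erase_subset j B)).mem

/-- The sets `C` avoiding `i` such that `insert i C` is rooted at `i`. -/
noncomputable def rootLink (ℬ : Finset (Finset ℕ)) (i : ℕ) : Finset (Finset ℕ) :=
  (ℬ.filter fun B => RootedAt ℬ B i).image fun B => B.erase i

lemma mem_rootLink : C ∈ rootLink ℬ i ↔ i ∉ C ∧ RootedAt ℬ (insert i C) i := by
  simp only [rootLink, Finset.mem_image, Finset.mem_filter]
  constructor
  · rintro ⟨B, ⟨_, hr⟩, rfl⟩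
    exact ⟨Finset.notMem_erase _ _, by rwa [Finset.insert_erase hr.1]⟩
  · rintro ⟨h1, h2⟩
    exact ⟨_, ⟨h2.mem, h2⟩, Finset.erase_insert h1⟩

/-- The union of the links of the elements of `S`. -/
noncomputable def rootLinks (ℬ : Finset (Finset ℕ)) (S : Finset ℕ) : Finset (Finset ℕ) :=
  S.biUnion (rootLink ℬ)

lemma mem_rootLinks : C ∈ rootLinks ℬ S ↔ ∃ i ∈ S, C ∈ rootLink ℬ i := by
  simp [rootLinks]

lemma rootLink_mono (hBC : B ⊆ C) (h : C ∈ rootLink ℬ i) : B ∈ rootLink ℬ i := by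
  rw [mem_rootLink] at *
  exact ⟨fun hi => h.1 (hBC hi),
    h.2.mono (Finset.mem_insert_self _ _) (Finset.insert_subset_insert _ hBC)⟩

lemma isLowerSet_rootLinks : IsLowerSet (rootLinks ℬ S : Set (Finset ℕ)) := by
  intro C B hBC hC
  simp only [Finset.mem_coe, mem_rootLinks] at *
  obtain ⟨i, hi, h⟩ := hC
  exact ⟨i, hi, rootLink_mono hBC h⟩

lemma subset_of_mem_rootLinks (hV : ∀ B ∈ ℬ, B ⊆ V) (h : C ∈ rootLinks ℬ S) : C ⊆ V := by
  obtain ⟨i, _, h⟩ := mem_rootLinks.1 h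
  exact (Finset.subset_insert _ _).trans (hV _ (mem_rootLink.1 h).2.mem)

/-- `X` behaves like the result of down-compressing `ℬ` in the directions of `J`. -/
structure IsCompressed (ℬ : Finset (Finset ℕ)) (J : Finset ℕ) (X : Finset (Finset ℕ)) :
    Prop where
  card_eq : X.card = ℬ.card
  erase_mem : ∀ k ∈ J, ∀ C ∈ X, C.erase k ∈ X
  mem_of_rootedAt : ∀ b ∉ J, ∀ B, RootedAt ℬ B b → B ∈ X
  rootLink_subset : ∀ j ∈ J, rootLink ℬ j ⊆ X
  rooted_or : ∀ C ∈ X, (∃ b, b ∉ J ∧ RootedAt ℬ C b) ∨ ∀ K, Disjoint K J → C \ K ∈ X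
  exists_superset : ∀ C ∈ X, ∃ B ∈ ℬ, C ⊆ B

lemma SimplyRooted.isCompressed_empty (h : SimplyRooted ℬ) : IsCompressed ℬ ∅ ℬ where
  card_eq := rfl
  erase_mem := by simp
  mem_of_rootedAt _ _ _ h := h.mem
  rootLink_subset := by simp
  rooted_or C hC := by
    obtain rfl | hne := C.eq_empty_or_nonempty
    · exact Or.inr fun K _ => by simpa using hC
    · obtain ⟨b, hb, h'⟩ := h C hC hne
      exact Or.inl ⟨b, Finset.notMem_empty b, hb, h'⟩
  exists_superset C hC := ⟨C, hC, subset_rfl⟩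

lemma mem_downCompression : C ∈ Down.compression j X ↔
    (C ∈ X ∧ C.erase j ∈ X) ∨ (j ∉ C ∧ insert j C ∈ X) := by
  rw [Down.mem_compression]
  constructor
  · rintro (h | ⟨h1, h2⟩)
    · exact Or.inl h
    · refine Or.inr ⟨fun hj => h1 ?_, h2⟩
      rwa [Finset.insert_eq_of_mem hj] at h2
  · rintro (h | ⟨h1, h2⟩)
    · exact Or.inl h
    · by_cases hC : C ∈ X
      · exact Or.inl ⟨hC, by rwa [Finset.erase_eq_of_notMem h1]⟩
      · exact Or.inr ⟨hC, h2⟩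

/-- A set moved by a compression in a new direction `j` is rooted at `j`. -/
lemma IsCompressed.rootedAt_of_erase_notMem (h : IsCompressed ℬ J X) (hj : j ∉ J) (hC : C ∈ X)
    (hCj : C.erase j ∉ X) : RootedAt ℬ C j := by
  obtain ⟨b, hb, hr⟩ | h' := h.rooted_or C hC
  · obtain rfl | hne := eq_or_ne j b
    · exact hr
    · refine absurd (h.mem_of_rootedAt b hb _ (hr.mono ?_ (Finset.erase_subset j C))) hCj
      exact Finset.mem_erase.2 ⟨hne.symm, hr.1⟩
  · have := h' {j} (by simpa using hj)
    rw [Finset.sdiff_singleton_eq_erase] at this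
    exact absurd this hCj

lemma IsCompressed.step (h : IsCompressed ℬ J X) (hj : j ∉ J) :
    IsCompressed ℬ (insert j J) (Down.compression j X) where
  card_eq := by rw [Down.card_compression, h.card_eq]
  erase_mem k hk C hC := by
    obtain rfl | hkj := eq_or_ne k j
    · exact Down.erase_mem_compression_of_mem_compression hC
    replace hk : k ∈ J := (Finset.mem_insert.1 hk).resolve_left hkj
    rw [mem_downCompression] at *
    obtain ⟨h1, h2⟩ | ⟨h1, h2⟩ := hC
    · exact Or.inl ⟨h.erase_mem k hk _ h1, by
        rw [Finset.erase_right_comm]; exact h.erase_mem k hk _ h2⟩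
    · refine Or.inr ⟨fun hh => h1 (Finset.mem_of_mem_erase hh), ?_⟩
      rw [← Finset.erase_insert_of_ne hkj.symm]
      exact h.erase_mem k hk _ h2
  mem_of_rootedAt b hb B hB := by
    rw [Finset.mem_insert, not_or] at hb
    refine mem_downCompression.2 (Or.inl ⟨h.mem_of_rootedAt b hb.2 B hB,
      h.mem_of_rootedAt b hb.2 _ (hB.mono ?_ (Finset.erase_subset j B))⟩)
    exact Finset.mem_erase.2 ⟨hb.1, hB.1⟩
  rootLink_subset k hk C hC := by
    rw [mem_downCompression]
    obtain rfl | hkj := eq_or_ne k j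
    · rw [mem_rootLink] at hC
      exact Or.inr ⟨hC.1, h.mem_of_rootedAt k hj _ hC.2⟩
    replace hk : k ∈ J := (Finset.mem_insert.1 hk).resolve_left hkj
    exact Or.inl ⟨h.rootLink_subset k hk hC,
      h.rootLink_subset k hk (rootLink_mono (Finset.erase_subset j C) hC)⟩
  rooted_or C hC := by
    have key : ∀ K, j ∉ K → RootedAt ℬ (insert j C) j → insert j C \ K ∈ X := fun K hK hr =>
      h.mem_of_rootedAt j hj _ (hr.mono (by simp [hK]) Finset.sdiff_subset)
    have hcomm : ∀ K : Finset ℕ, (C \ K).erase j = C.erase j \ K := fun K =>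
      (Finset.erase_sdiff_comm C K j).symm
    have hdisj : ∀ K : Finset ℕ, Disjoint K (insert j J) → j ∉ K ∧ Disjoint K J := by
      intro K hK
      rwa [Finset.disjoint_insert_right] at hK
    by_cases hCX : C ∈ X ∧ C.erase j ∈ X
    · obtain ⟨b, hb, hr⟩ | h' := h.rooted_or C hCX.1
      · by_cases hbj : b = j
        swap
        · exact Or.inl ⟨b, by simp [hbj, hb], hr⟩
        subst hbj
        obtain ⟨c, hc, hrc⟩ | h' := h.rooted_or _ hCX.2
        · refine Or.inl ⟨c, ?_, ?_⟩
          · have := (Finset.mem_erase.1 hrc.1).1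
            simp [this, hc]
          · refine ⟨Finset.mem_of_mem_erase hrc.1, fun D hcD hDC => ?_⟩
            by_cases hbD : b ∈ D
            · exact hr.2 D (by simpa using hbD) hDC
            · refine hrc.2 D hcD fun x hx => Finset.mem_erase.2 ⟨?_, hDC hx⟩
              rintro rfl
              exact hbD hx
        · refine Or.inr fun K hK => mem_downCompression.2 (Or.inl ⟨?_, ?_⟩)
          · have := key K (hdisj K hK).1
            rw [Finset.insert_eq_of_mem hr.1] at this
            exact this hr
          · rw [hcomm]
            exact h' K (hdisj K hK).2
      · refine Or.inr fun K hK => mem_downCompression.2 (Or.inl ⟨h' K (hdisj K hK).2, ?_⟩)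
        have := h' (insert j K) (by simp [hj, (hdisj K hK).2])
        rwa [Finset.sdiff_insert] at this
    · rw [mem_downCompression, or_iff_right hCX] at hC
      have hCX' : C ∉ X := by
        rw [Finset.erase_eq_of_notMem hC.1] at hCX
        exact fun h => hCX ⟨h, h⟩
      have hr : RootedAt ℬ (insert j C) j := h.rootedAt_of_erase_notMem hj hC.2 (by
        rwa [Finset.erase_insert hC.1])
      refine Or.inr fun K hK => mem_downCompression.2 (Or.inr ⟨?_, ?_⟩)
      · simp [hC.1]
      · rw [← Finset.insert_sdiff_of_notMem _ (hdisj K hK).1]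
        exact key K (hdisj K hK).1 hr
  exists_superset C hC := by
    obtain ⟨h1, _⟩ | ⟨_, h2⟩ := mem_downCompression.1 hC
    · exact h.exists_superset C h1
    · obtain ⟨B, hB, hCB⟩ := h.exists_superset _ h2
      exact ⟨B, hB, (Finset.subset_insert j C).trans hCB⟩

/-- The number of sets of the family containing `k`. -/
def degreeIn (X : Finset (Finset ℕ)) (k : ℕ) : ℕ := (X.filter fun C => k ∈ C).card

lemma degreeIn_compression_of_ne {k : ℕ} (hkj : k ≠ j) :
    degreeIn (Down.compression j X) k = degreeIn X k := by
  unfold degreeIn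
  rw [← Down.card_compression j (X.filter fun C => k ∈ C)]
  congr 1
  ext C
  simp only [Finset.mem_filter, mem_downCompression, Finset.mem_erase, Finset.mem_insert, hkj,
    false_or, ne_eq, not_false_eq_true, true_and]
  tauto

/-- A compression in a new direction `j` only loses sets whose images are new sets in the link
of `j`. -/
lemma IsCompressed.degreeIn_le (h : IsCompressed ℬ J X) (hj : j ∉ J) :
    degreeIn X j ≤ degreeIn (Down.compression j X) j +
      (rootLink ℬ j \ rootLinks ℬ J).card := by
  unfold degreeIn
  rw [← Finset.card_filter_add_card_filter_not (s := X.filter fun C => j ∈ C)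
    (fun C => C.erase j ∈ X)]
  refine Nat.add_le_add (Finset.card_le_card ?_) ?_
  · intro C
    simp only [Finset.mem_filter, mem_downCompression]
    tauto
  · refine Finset.card_le_card_of_injOn (fun C => C.erase j) ?_ ?_
    · intro C hC
      simp only [Finset.coe_filter, Finset.mem_filter, Set.mem_ofPred_eq] at hC
      have hr := h.rootedAt_of_erase_notMem hj hC.1.1 hC.2
      rw [Finset.mem_coe, Finset.mem_sdiff, mem_rootLink, mem_rootLinks, Finset.insert_erase hr.1]
      refine ⟨⟨Finset.notMem_erase _ _, hr⟩, ?_⟩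
      rintro ⟨k, hk, hk'⟩
      exact hC.2 (h.rootLink_subset k hk hk')
    · intro C hC D hD hCD
      simp only [Finset.coe_filter, Finset.mem_filter, Set.mem_ofPred_eq] at hC hD
      rw [← Finset.insert_erase hC.1.2, ← Finset.insert_erase hD.1.2]
      exact congrArg (insert j) hCD

lemma IsCompressed.exists_of_subset (h : IsCompressed ℬ J X) (T S : Finset ℕ)
    (hTS : ∀ j ∈ S, j ∉ J ∧ j ∈ T) :
    ∃ Y, IsCompressed ℬ (J ∪ S) Y ∧ (∀ k ∉ T, degreeIn Y k = degreeIn X k) ∧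
      ∑ k ∈ T, degreeIn X k ≤
        ∑ k ∈ T, degreeIn Y k + (rootLinks ℬ (J ∪ S) \ rootLinks ℬ J).card := by
  induction S using Finset.induction_on with
  | empty => exact ⟨X, by simpa using h, fun _ _ => rfl, Nat.le_add_right _ _⟩
  | insert j S hjS ih =>
    obtain ⟨Y, hY, hdeg, hsum⟩ := ih fun i hi => hTS i (Finset.mem_insert_of_mem hi)
    obtain ⟨hjJ, hjT⟩ := hTS j (Finset.mem_insert_self _ _)
    have hj : j ∉ J ∪ S := by simp [hjJ, hjS]
    rw [Finset.union_insert]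
    refine ⟨_, hY.step hj, fun k hk => ?_, ?_⟩
    · rw [degreeIn_compression_of_ne (by rintro rfl; exact hk hjT), hdeg k hk]
    · have h1 := hY.degreeIn_le hj
      have h2 : ∑ k ∈ T.erase j, degreeIn (Down.compression j Y) k =
          ∑ k ∈ T.erase j, degreeIn Y k := Finset.sum_congr rfl fun k hk =>
        degreeIn_compression_of_ne (Finset.ne_of_mem_erase hk)
      have h3 : (rootLink ℬ j \ rootLinks ℬ (J ∪ S)).card +
          (rootLinks ℬ (J ∪ S) \ rootLinks ℬ J).card ≤
          (rootLinks ℬ (insert j (J ∪ S)) \ rootLinks ℬ J).card := by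
        rw [← Finset.card_union_of_disjoint
          (Finset.disjoint_of_subset_right Finset.sdiff_subset Finset.sdiff_disjoint)]
        refine Finset.card_le_card fun C => ?_
        simp only [Finset.mem_union, Finset.mem_sdiff, mem_rootLinks, Finset.mem_insert]
        grind
      rw [← Finset.add_sum_erase T _ hjT] at hsum ⊢
      rw [← Finset.add_sum_erase T (fun k => degreeIn Y k) hjT] at hsum
      rw [← Finset.add_sum_erase T (fun k => degreeIn (Down.compression j Y) k) hjT, h2]
      omega

lemma totalSize_eq_sum_degreeIn (h : ∀ C ∈ X, C ⊆ V) :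
    totalSize X = ∑ k ∈ V, degreeIn X k := by
  have := Finset.sum_card_bipartiteAbove_eq_sum_card_bipartiteBelow (s := X) (t := V)
    fun C k => k ∈ C
  rw [totalSize, show (∑ k ∈ V, degreeIn X k) = _ from this.symm]
  refine Finset.sum_congr rfl fun C hC => ?_
  rw [Finset.bipartiteAbove, Finset.filter_mem_eq_inter, Finset.inter_eq_right.2 (h C hC)]

lemma rootLinks_singleton : rootLinks ℬ {i} = rootLink ℬ i := Finset.singleton_biUnion

lemma rootLinks_mono (h : J ⊆ S) : rootLinks ℬ J ⊆ rootLinks ℬ S :=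
  Finset.biUnion_subset_biUnion_of_subset_left _ h

lemma rootLinks_union : rootLinks ℬ (J ∪ S) = rootLinks ℬ J ∪ rootLinks ℬ S :=
  Finset.union_biUnion

lemma IsCompressed.rootLinks_subset (h : IsCompressed ℬ J X) : rootLinks ℬ J ⊆ X :=
  Finset.biUnion_subset.2 h.rootLink_subset

lemma SimplyRooted.exists_isCompressed (h : SimplyRooted ℬ) (hi : i ∈ V) :
    ∃ X, IsCompressed ℬ V X ∧ degreeIn ℬ i ≤ degreeIn X i + (rootLink ℬ i).card ∧
      ∑ k ∈ V.erase i, degreeIn ℬ k ≤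
        ∑ k ∈ V.erase i, degreeIn X k + (rootLinks ℬ V \ rootLink ℬ i).card := by
  have h0 := h.isCompressed_empty
  have h1 := h0.step (Finset.notMem_empty i)
  obtain ⟨Y, hY, hdeg, hsum⟩ := h1.exists_of_subset (V.erase i) (V.erase i) fun j hj =>
    ⟨by simpa using (Finset.mem_erase.1 hj).1, hj⟩
  have hV : insert i ∅ ∪ V.erase i = V := by
    rw [Finset.insert_union, Finset.empty_union, Finset.insert_erase hi]
  rw [hV] at hY hsum
  refine ⟨Y, hY, ?_, ?_⟩
  · rw [hdeg i (Finset.notMem_erase i V)]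
    simpa [rootLinks] using h0.degreeIn_le (Finset.notMem_empty i)
  · rw [insert_empty_eq, rootLinks_singleton] at hsum
    refine le_trans (le_of_eq ?_) hsum
    exact Finset.sum_congr rfl fun k hk =>
      (degreeIn_compression_of_ne (Finset.ne_of_mem_erase hk)).symm

lemma RootedAt.rootedFam (h : RootedAt ℬ B i) (hi : i ∈ S) : RootedAt (rootedFam ℬ S) B i := by
  refine ⟨h.1, fun C hiC hCB => ?_⟩
  have hC := h.mono (by simpa using hiC) hCB
  exact Finset.mem_filter.2 ⟨hC.mem, i, hi, hC⟩

lemma simplyRooted_rootedFam : SimplyRooted (rootedFam ℬ S) := by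
  intro B hB _
  obtain ⟨_, i, hi, hr⟩ := Finset.mem_filter.1 hB
  exact ⟨i, hr.rootedFam hi⟩

lemma card_rootLinks_le : (rootLinks ℬ S).card ≤ (rootedFam ℬ S).card := by
  obtain ⟨Y, hY, -⟩ := (simplyRooted_rootedFam (ℬ := ℬ) (S := S)).isCompressed_empty.exists_of_subset
    S S fun j hj => ⟨Finset.notMem_empty j, hj⟩
  rw [Finset.empty_union] at hY
  rw [← hY.card_eq]
  refine Finset.card_le_card fun C hC => ?_
  obtain ⟨i, hi, hC⟩ := mem_rootLinks.1 hC
  refine hY.rootLink_subset i hi ?_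
  rw [mem_rootLink] at *
  exact ⟨hC.1, hC.2.rootedFam hi⟩

/-- The sets of the family whose whole shadow lies in the family. -/
noncomputable def shadowClosed (ℬ : Finset (Finset ℕ)) : Finset (Finset ℕ) :=
  ℬ.filter fun B => ∀ x ∈ B, B.erase x ∈ ℬ

lemma card_rootLinks_add_card_rootLinks_le (h : Disjoint J S) :
    (rootLinks ℬ J).card + (rootLinks ℬ S).card ≤ ℬ.card + (shadowClosed ℬ).card := by
  refine (Nat.add_le_add card_rootLinks_le card_rootLinks_le).trans ?_
  rw [← Finset.card_union_add_card_inter]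
  refine Nat.add_le_add (Finset.card_le_card ?_) (Finset.card_le_card ?_)
  · exact Finset.union_subset (Finset.filter_subset _ _) (Finset.filter_subset _ _)
  · intro B hB
    simp only [Finset.mem_inter, rootedFam, Finset.mem_filter] at hB
    obtain ⟨⟨hB, i, hi, hri⟩, -, j, hj, hrj⟩ := hB
    refine Finset.mem_filter.2 ⟨hB, fun x _ => ?_⟩
    by_cases hx : x = i
    · refine hrj.erase_mem ?_
      rintro rfl
      exact Finset.disjoint_left.1 h (hx ▸ hi) hj
    · exact hri.erase_mem hx

lemma SimplyRooted.totalSize_add_le (h : SimplyRooted ℬ) :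
    totalSize ℬ + (shadowClosed ℬ).card ≤ cubeEdges ℬ + ℬ.card := by
  rw [totalSize, cubeEdges, shadowClosed, Finset.card_filter, Finset.card_eq_sum_ones,
    ← Finset.sum_add_distrib, ← Finset.sum_add_distrib]
  refine Finset.sum_le_sum fun B hB => ?_
  split_ifs with hf
  · rw [Finset.filter_true_of_mem hf]
  · obtain rfl | hne := B.eq_empty_or_nonempty
    · simp
    obtain ⟨b, hr⟩ := h B hB hne
    have hr : RootedAt ℬ B b := hr
    rw [add_zero, ← Finset.card_erase_add_one hr.1]
    refine Nat.add_le_add_right (Finset.card_le_card fun x hx => ?_) 1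
    rw [Finset.mem_erase] at hx
    exact Finset.mem_filter.2 ⟨hx.2, hr.erase_mem hx.1⟩

/-- The ground set can be split so that the links of the two parts have nearly equal size. -/
lemma exists_balanced {W : ℕ} (hW : ∀ i ∈ V, (rootLink ℬ i).card ≤ W) :
    ∃ S ⊆ V, |((rootLinks ℬ S).card : ℤ) - (rootLinks ℬ (V \ S)).card| ≤ W := by
  by_contra! hcon
  have hneg : ∀ S ⊆ V, ((rootLinks ℬ S).card : ℤ) - (rootLinks ℬ (V \ S)).card < -W := by
    intro S
    induction S using Finset.induction_on with
    | empty =>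
      intro hS
      have := hcon ∅ hS
      simp only [rootLinks, Finset.biUnion_empty, Finset.card_empty] at *
      rw [lt_abs] at this
      omega
    | insert j S hjS ih =>
      intro hS
      have h1 := ih ((Finset.subset_insert j S).trans hS)
      have h2 := hcon _ hS
      have hjV := hS (Finset.mem_insert_self j S)
      have hj := hW j hjV
      have h3 : (rootLinks ℬ (insert j S)).card ≤ (rootLink ℬ j).card + (rootLinks ℬ S).card := by
        rw [rootLinks, Finset.biUnion_insert]
        exact Finset.card_union_le _ _
      have h4 : (rootLinks ℬ (V \ S)).card ≤
          (rootLink ℬ j).card + (rootLinks ℬ (V \ insert j S)).card := by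
        rw [show V \ S = insert j (V \ insert j S) by grind, rootLinks, Finset.biUnion_insert]
        exact Finset.card_union_le _ _
      rw [lt_abs] at h2
      omega
  have h := hneg V subset_rfl
  simp only [rootLinks, sdiff_self, Finset.bot_eq_empty, Finset.biUnion_empty,
    Finset.card_empty] at h
  omega

lemma card_mul_le_two_mul_sum_degreeIn (h : ∀ i ∈ V, ℬ.card < 2 * degreeIn ℬ i) (hS : S ⊆ V) :
    S.card * ℬ.card ≤ 2 * ∑ k ∈ S, degreeIn ℬ k := by
  rw [Finset.mul_sum, ← smul_eq_mul]
  exact Finset.card_nsmul_le_sum _ _ _ fun k hk => (h k (hS hk)).le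

lemma thirteen_mul_le {w q o m : ℕ} (hm : 0 < m) (hq : 24 * o + 11 * m ≤ 24 * q)
    (ho : 12 * o < m) (h : 2 * (w * q) ≤ 3 * m * o) : 13 * w ≤ 3 * m := by
  by_contra! hw
  have h1 := Nat.mul_le_mul_left w hq
  have h2 := Nat.mul_le_mul_right (24 * o + 11 * m) hw.le
  have h3 := Nat.mul_lt_mul_of_pos_left ho hm
  ring_nf at h h1 h2 h3
  linarith

lemma false_of_balanced {m u o a b : ℕ} (hmpos : 0 < m) (hu : 23 * m < 24 * u)
    (h1 : a + b = u + o) (hab : 13 * |(a : ℤ) - b| ≤ 3 * m) (h4 : a * b ≤ 3 * m * o)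
    (ho : 12 * o < m) : False := by
  have h5 : 169 * ((a : ℤ) - b) ^ 2 ≤ 9 * (m : ℤ) ^ 2 := by
    have := mul_self_le_mul_self (by positivity) hab
    rw [← sq_abs]
    linarith
  zify at h4 h1 hu ho
  have h6 : 169 * ((u : ℤ) + o) ^ 2 ≤ 9 * (m : ℤ) ^ 2 + 169 * 12 * m * o := by
    rw [← h1, show ((a : ℤ) + b) ^ 2 = (a - b) ^ 2 + 4 * (a * b) by ring]
    linarith
  have h7 : (23 * (m : ℤ) + 24 * o) ^ 2 ≤ (24 * (u + o)) ^ 2 :=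
    pow_le_pow_left₀ (by positivity) (by linarith) 2
  have hm : 0 < (m : ℤ) := by exact_mod_cast hmpos
  have h8 : 12 * ((m : ℤ) * o) ≤ m * m := by nlinarith
  linarith [mul_pos hm hm, sq_nonneg (o : ℤ)]

/-- A simply rooted family in which every element has degree above one half has a large colex
initial segment. -/
theorem SimplyRooted.lt_colexSize (hr : SimplyRooted ℬ) (hV : ∀ B ∈ ℬ, B ⊆ V)
    (hne : V.Nonempty) (hdeg : ∀ i ∈ V, ℬ.card < 2 * degreeIn ℬ i) :
    12 * (ℬ.card * V.card) < 24 * colexSize ℬ.card + 23 * ℬ.card := by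
  by_contra! hcon
  rw [mul_comm ℬ.card V.card] at hcon
  obtain ⟨i₀, hi₀⟩ := hne
  have hsize : V.card * ℬ.card < 2 * totalSize ℬ := by
    rw [totalSize_eq_sum_degreeIn hV, Finset.mul_sum, ← smul_eq_mul, ← Finset.sum_const]
    exact Finset.sum_lt_sum_of_nonempty ⟨i₀, hi₀⟩ hdeg
  have hmpos : 0 < ℬ.card := by
    have h1 := hdeg i₀ hi₀
    have h2 : degreeIn ℬ i₀ ≤ ℬ.card := Finset.card_filter_le _ _
    omega
  have hedge := hr.totalSize_add_le
  have hiso := cubeEdges_le_colexSize ℬ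
  have hsub : ∀ S ⊆ V, (rootLinks ℬ S).card + (rootLinks ℬ (V \ S)).card =
      (rootLinks ℬ V).card + (rootLinks ℬ S ∩ rootLinks ℬ (V \ S)).card := fun S hS => by
    rw [← Finset.card_union_add_card_inter, ← rootLinks_union, Finset.union_sdiff_of_subset hS]
  have hbad : ∀ S, (rootLinks ℬ S).card + (rootLinks ℬ (V \ S)).card ≤
      ℬ.card + (shadowClosed ℬ).card := fun S =>
    card_rootLinks_add_card_rootLinks_le Finset.disjoint_sdiff
  have hlow : 2 ^ V.card < 3 * ℬ.card := by
    by_contra! h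
    have := two_mul_colexSize_add_le h
    rw [mul_comm ℬ.card V.card] at this
    omega
  have hφ : 24 * (shadowClosed ℬ).card < ℬ.card := by omega
  have hcomp : ∀ i ∈ V, ∃ D : Finset (Finset ℕ), rootLinks ℬ V ⊆ D ∧
      totalSize ℬ ≤ totalSize D + (rootLinks ℬ V).card ∧ totalSize D ≤ colexSize ℬ.card ∧
      24 * degreeIn D i + 24 * (rootLink ℬ i).card + 11 * ℬ.card ≤
        24 * (rootLinks ℬ V).card := by
    intro i hi
    obtain ⟨D, hD, h1, h2⟩ := hr.exists_isCompressed hi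
    have hDV : ∀ C ∈ D, C ⊆ V := fun C hC => by
      obtain ⟨B, hB, hCB⟩ := hD.exists_superset C hC
      exact hCB.trans (hV B hB)
    have h3 : totalSize D ≤ colexSize ℬ.card := by
      rw [← hD.card_eq]
      exact totalSize_le_colexSize fun C hC k hk => hD.erase_mem k (hDV C hC hk) C hC
    have h4 : (rootLinks ℬ V \ rootLink ℬ i).card + (rootLink ℬ i).card =
        (rootLinks ℬ V).card :=
      Finset.card_sdiff_add_card_eq_card (Finset.subset_biUnion_of_mem (rootLink ℬ) hi)
    have h5 := card_mul_le_two_mul_sum_degreeIn hdeg (Finset.erase_subset i V)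
    have h6 := Finset.add_sum_erase V (fun k => degreeIn D k) hi
    have h7 := Finset.add_sum_erase V (fun k => degreeIn ℬ k) hi
    rw [← totalSize_eq_sum_degreeIn hDV] at h6
    rw [← totalSize_eq_sum_degreeIn hV] at h7
    have h8 : (V.erase i).card * ℬ.card + ℬ.card = V.card * ℬ.card := by
      rw [← Finset.card_erase_add_one hi]
      ring
    exact ⟨D, hD.rootLinks_subset, by omega, h3, by omega⟩
  have hu : 23 * ℬ.card < 24 * (rootLinks ℬ V).card := by
    obtain ⟨D, -, h1, h2, -⟩ := hcomp i₀ hi₀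
    omega
  have hlink : ∀ i ∈ V, 13 * (rootLink ℬ i).card ≤ 3 * ℬ.card := by
    intro i hi
    obtain ⟨D, hD, -, -, h1⟩ := hcomp i hi
    have h2 := hsub {i} (by simpa using hi)
    have h3 := hbad {i}
    rw [rootLinks_singleton] at h2 h3
    set P := rootLinks ℬ (V \ {i}) with hP
    have h4 : (P.filter fun C => i ∈ C).card ≤ degreeIn D i :=
      Finset.card_le_card (Finset.filter_subset_filter _
        ((rootLinks_mono Finset.sdiff_subset).trans hD))
    have h5 := Finset.card_filter_add_card_filter_not (s := P) (fun C => i ∈ C)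
    have h6 : (rootLink ℬ i).card * (P.filter fun C => i ∉ C).card ≤
        2 ^ (V.erase i).card * (rootLink ℬ i ∩ P).card := by
      refine (IsLowerSet.le_card_inter_finset' (s := V.erase i) ?_ ?_ ?_ ?_).trans
        (Nat.mul_le_mul_left _ (Finset.card_le_card
          (Finset.inter_subset_inter_left (Finset.filter_subset _ _))))
      · exact fun C B hBC hC => rootLink_mono hBC hC
      · exact isLowerSet_rootLinks.nonMemberSubfamily (a := i)
      · intro C hC
        rw [← rootLinks_singleton] at hC
        refine Finset.subset_erase.2 ⟨subset_of_mem_rootLinks hV hC, ?_⟩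
        rw [rootLinks_singleton] at hC
        exact (mem_rootLink.1 hC).1
      · intro C hC
        rw [Finset.mem_filter] at hC
        exact Finset.subset_erase.2 ⟨subset_of_mem_rootLinks hV hC.1, hC.2⟩
    have h7 : 2 * 2 ^ (V.erase i).card ≤ 3 * ℬ.card := by
      rw [← pow_succ', Finset.card_erase_add_one hi]
      exact hlow.le
    have h8 : 24 * (rootLink ℬ i ∩ P).card + 11 * ℬ.card ≤
        24 * (P.filter fun C => i ∉ C).card := by omega
    have h9 : 12 * (rootLink ℬ i ∩ P).card < ℬ.card := by omega
    generalize (rootLink ℬ i ∩ P).card = o at *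
    generalize (P.filter fun C => i ∉ C).card = q at *
    have h10 : 2 * ((rootLink ℬ i).card * q) ≤ 3 * ℬ.card * o := by
      calc _ ≤ 2 * (2 ^ (V.erase i).card * o) := by omega
        _ = 2 * 2 ^ (V.erase i).card * o := by ring
        _ ≤ _ := Nat.mul_le_mul_right _ h7
    exact thirteen_mul_le hmpos h8 h9 h10
  obtain ⟨S, hS, hbal⟩ := exists_balanced (ℬ := ℬ) (V := V) (W := 3 * ℬ.card / 13)
    fun i hi => by have := hlink i hi; omega
  have h1 := hsub S hS
  have h2 := hbad S
  have h3 := IsLowerSet.le_card_inter_finset' (isLowerSet_rootLinks (ℬ := ℬ) (S := S))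
    (isLowerSet_rootLinks (ℬ := ℬ) (S := V \ S)) (fun C => subset_of_mem_rootLinks hV)
    (fun C => subset_of_mem_rootLinks hV)
  generalize (rootLinks ℬ S ∩ rootLinks ℬ (V \ S)).card = o at *
  generalize (rootLinks ℬ S).card = a at *
  generalize (rootLinks ℬ (V \ S)).card = a' at *
  generalize (rootLinks ℬ V).card = u at *
  have h4 : a * a' ≤ 3 * ℬ.card * o := h3.trans (Nat.mul_le_mul_right _ hlow.le)
  have ho : 12 * o < ℬ.card := by omega
  have hbal' : 13 * |(a : ℤ) - a'| ≤ 3 * ℬ.card := by omega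
  exact false_of_balanced hmpos hu h1 hbal' h4 ho

end Rooted

lemma UnionClosed.simplyRooted_sdiff {𝒜 : Finset (Finset ℕ)} (h : UnionClosed 𝒜) (V : Finset ℕ) :
    SimplyRooted (V.powerset \ 𝒜) := by
  intro B hB hne
  rw [Finset.mem_sdiff, Finset.mem_powerset] at hB
  by_contra! hcon
  choose! f hf using hcon
  refine hB.2 ?_
  have hsup : B.sup' hne f = B := by
    refine le_antisymm (Finset.sup'_le _ _ fun b hb => (hf b hb).2.1) fun b hb => ?_
    exact Finset.le_sup' f hb (Finset.singleton_subset_iff.1 (hf b hb).1)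
  rw [← hsup]
  refine Finset.sup'_mem (𝒜 : Set (Finset ℕ)) (fun A hA C hC => h A hA C hC) B hne f
    fun b hb => ?_
  have := (hf b hb).2.2
  rw [Finset.mem_sdiff, not_and, not_not, Finset.mem_powerset] at this
  exact this ((hf b hb).2.1.trans hB.1)

lemma degreeIn_add_degreeIn_sdiff {𝒜 : Finset (Finset ℕ)} {V : Finset ℕ} (h : 𝒜 ⊆ V.powerset)
    {i : ℕ} (hi : i ∈ V) :
    2 * (degreeIn 𝒜 i + degreeIn (V.powerset \ 𝒜) i) = 𝒜.card + (V.powerset \ 𝒜).card := by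
  have h1 : degreeIn 𝒜 i + degreeIn (V.powerset \ 𝒜) i = degreeIn V.powerset i := by
    unfold degreeIn
    rw [← Finset.card_union_of_disjoint (Finset.disjoint_filter_filter Finset.disjoint_sdiff),
      ← Finset.filter_union, Finset.union_sdiff_of_subset h]
  have h2 : degreeIn V.powerset i = 2 ^ (V.erase i).card := by
    rw [← Finset.card_powerset]
    refine Finset.card_bij' (fun C _ => C.erase i) (fun C _ => insert i C) ?_ ?_ ?_ ?_
    · intro C hC
      simp only [Finset.mem_filter, Finset.mem_powerset] at hC ⊢
      exact Finset.erase_subset_erase i hC.1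
    · intro C hC
      simp only [Finset.mem_filter, Finset.mem_powerset] at hC ⊢
      exact ⟨Finset.insert_subset hi (hC.trans (Finset.erase_subset i V)),
        Finset.mem_insert_self i C⟩
    · intro C hC
      exact Finset.insert_erase (Finset.mem_filter.1 hC).2
    · intro C hC
      exact Finset.erase_insert fun h =>
        Finset.notMem_erase i V (Finset.mem_powerset.1 hC h)
  rw [h1, h2, add_comm 𝒜.card, Finset.card_sdiff_add_card_eq_card h, Finset.card_powerset,
    ← pow_succ', Finset.card_erase_add_one hi]

/-- If `𝒜 ⊆ 𝒫(n)` is a counterexample to the union-closed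
conjecture and `ℬ = 𝒫(n) \ 𝒜` with `|ℬ| = m`, then
`‖I(m)‖ > m(n/2 - 1 + 1/24)`. -/
theorem stmt2 (n : ℕ) (𝒜 ℬ : Finset (Finset ℕ)) (h : UCCounterexample n 𝒜)
    (hB : ℬ = (Finset.Icc 1 n).powerset \ 𝒜) (m : ℕ) (hm : m = ℬ.card) :
    (m : ℚ) * ((n : ℚ) / 2 - 1 + 1 / 24) < (totalSize (colexInit m) : ℚ) := by
  obtain ⟨hsub, huc, hne, hdeg⟩ := h
  obtain rfl | hn := Nat.eq_zero_or_pos n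
  · have hA : 𝒜 = ∅ := by
      simpa [Finset.subset_singleton_iff, hne] using hsub
    have hm1 : m = 1 := by simp [hm, hB, hA]
    have h0 : (0 : ℚ) ≤ totalSize (colexInit m) := Nat.cast_nonneg _
    refine lt_of_lt_of_le ?_ h0
    norm_num [hm1]
  · have key := (hB ▸ huc.simplyRooted_sdiff (Finset.Icc 1 n) : SimplyRooted ℬ).lt_colexSize
      (V := Finset.Icc 1 n) (fun B h => by
        rw [hB] at h
        exact Finset.mem_powerset.1 (Finset.mem_sdiff.1 h).1)
      ⟨1, Finset.mem_Icc.2 ⟨le_rfl, hn⟩⟩ fun i hi => by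
        have h1 := degreeIn_add_degreeIn_sdiff hsub hi
        have h2 : (degreeIn 𝒜 i : ℚ) < 𝒜.card / 2 := hdeg i hi
        have h3 : 2 * degreeIn 𝒜 i < 𝒜.card := by
          have h4 : (2 * degreeIn 𝒜 i : ℚ) < 𝒜.card := by linarith
          exact_mod_cast h4
        rw [← hB] at h1
        omega
    rw [Nat.card_Icc, Nat.add_sub_cancel, ← hm] at key
    rw [totalSize_colexInit_s2]
    have : (12 * (m * n) : ℚ) < 24 * colexSize m + 23 * m := by exact_mod_cast key
    linarith
end

section
/- Let 𝒜 ⊆ 𝒫(n) and let ℬ = 𝒫(n) ∖ 𝒜. Then ℬ is a simply rooted family if and only if 𝒜 is a union-closed family. -/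
open Finset
open scoped Classical

/-- For `𝒜 ⊆ 𝒫(n)` and `ℬ = 𝒫(n) \ 𝒜`, the family `ℬ` is
simply rooted iff `𝒜` is union-closed. -/
theorem stmt4 (n : ℕ) (𝒜 ℬ : Finset (Finset ℕ)) (hsub : 𝒜 ⊆ (Finset.Icc 1 n).powerset)
    (hB : ℬ = (Finset.Icc 1 n).powerset \ 𝒜) :
    SimplyRooted ℬ ↔ UnionClosed 𝒜 := by
  subst hB
  constructor
  · intro h A hA B hB
    by_contra hAB
    have hmem : A ∪ B ∈ (Finset.Icc 1 n).powerset \ 𝒜 :=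
      mem_sdiff.2 ⟨mem_powerset.2 (union_subset (mem_powerset.1 (hsub hA))
        (mem_powerset.1 (hsub hB))), hAB⟩
    rcases (A ∪ B).eq_empty_or_nonempty with he | hne
    · rw [he, ← (union_eq_empty.1 he).1] at hAB
      exact hAB hA
    · obtain ⟨b, hb, hcube⟩ := h _ hmem hne
      rcases mem_union.1 hb with hbA | hbB
      · exact (mem_sdiff.1 (hcube A (singleton_subset_iff.2 hbA) subset_union_left)).2 hA
      · exact (mem_sdiff.1 (hcube B (singleton_subset_iff.2 hbB) subset_union_right)).2 hB
  · intro h B hB hne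
    obtain ⟨hBn, hBA⟩ := mem_sdiff.1 hB
    by_contra! hroot
    have hcover : ∀ b ∈ B, ∃ C ∈ 𝒜, b ∈ C ∧ C ⊆ B := by
      intro b hb
      obtain ⟨C, hbC, hCB, hC⟩ := hroot b hb
      refine ⟨C, ?_, singleton_subset_iff.1 hbC, hCB⟩
      by_contra hCA
      exact hC (mem_sdiff.2 ⟨mem_powerset.2 (hCB.trans (mem_powerset.1 hBn)), hCA⟩)
    choose! f hfA hbf hfB using hcover
    have hsup : B.sup' hne f ∈ 𝒜 :=
      sup'_mem (𝒜 : Set (Finset ℕ)) (fun X hX Y hY => h X hX Y hY) B hne f hfA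
    have hsup_eq : B.sup' hne f = B :=
      le_antisymm (sup'_le hne f hfB) fun b hb => le_sup' f hb (hbf b hb)
    exact hBA (hsup_eq ▸ hsup)
end
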